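/- Let x and y be generic 4×4 matrices. The traces of the 17 matrices x, y, x², xy, y², x³, x²y, xy², y³, x⁴, x³y, x²y², xy³, y⁴, xyxy, (x²y)², (y²x)² form a homogeneous system of parameters of the algebra C_{4,2}: these 17 invariants are algebraically independent homogeneous elements, 17 equals the Krull dimension of C_{4,2}, and C_{4,2} is a finitely generated module over the subalgebra they generate. -/

import Mathlib

open MvPolynomial Matrix

noncomputable section

/-- Index type for the entries of a pair of generic `n × n` matrices:
`Sum.inl (i,j)` indexes the `(i,j)` entry of `x`, `Sum.inr (i,j)` that of `y`. -/
abbrev MatVar (n : ℕ) := (Fin n × Fin n) ⊕ (Fin n × Fin n)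

/-- The substitution sending the variables to the entries of the pair `(A, B)`. -/
def pairSub {K : Type*} [CommSemiring K] {n : ℕ} (A B : Matrix (Fin n) (Fin n) K) :
    MatVar n → K
  | Sum.inl ij => A ij.1 ij.2
  | Sum.inr ij => B ij.1 ij.2

/-- A polynomial function on pairs of `n × n` matrices is `GLₙ`-invariant (for the action
by simultaneous conjugation). -/
def IsMatInvariant {K : Type*} [Field K] {n : ℕ} (f : MvPolynomial (MatVar n) K) : Prop :=
  ∀ (a : GL (Fin n) K) (A B : Matrix (Fin n) (Fin n) K),
    MvPolynomial.eval
        (pairSub ((a : Matrix (Fin n) (Fin n) K) * A * ((a⁻¹ : GL (Fin n) K) : Matrix (Fin n) (Fin n) K))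
          ((a : Matrix (Fin n) (Fin n) K) * B * ((a⁻¹ : GL (Fin n) K) : Matrix (Fin n) (Fin n) K))) f =
      MvPolynomial.eval (pairSub A B) f

/-- The weight giving the bidegree: entries of `x` have weight `(1,0)`,
those of `y` have weight `(0,1)`. -/
def bideg (n : ℕ) : MatVar n → ℕ × ℕ
  | Sum.inl _ => (1, 0)
  | Sum.inr _ => (0, 1)

/-- The bigraded component of bidegree `(p, q)` of the pure trace algebra `C_{n,2}`. -/
def pureComponent (K : Type*) [Field K] (n p q : ℕ) : Set (MvPolynomial (MatVar n) K) :=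
  {f | IsMatInvariant f ∧ f.IsWeightedHomogeneous (bideg n) (p, q)}

/-- `dim_K C_{n,2}^{(p,q)}`. -/
def pureDim (K : Type*) [Field K] (n p q : ℕ) : ℕ :=
  Set.finrank K (pureComponent K n p q)

/-- The bigraded Poincaré series `P(C_{n,2}; s, t)`, with `s` the variable `X 0` and
`t` the variable `X 1`. -/
def purePS2 (K : Type*) [Field K] (n : ℕ) : MvPowerSeries (Fin 2) ℚ :=
  fun d => (pureDim K n (d 0) (d 1) : ℚ)

/-- abbreviation for the power series variable `s`. -/
def ps : MvPowerSeries (Fin 2) ℚ := MvPowerSeries.X 0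

/-- abbreviation for the power series variable `t`. -/
def pt : MvPowerSeries (Fin 2) ℚ := MvPowerSeries.X 1


/-- The pure trace algebra `C_{n,2}`: the subalgebra of `GLₙ`-invariant polynomial
functions on pairs of `n × n` matrices. -/
def pureAlg (K : Type*) [Field K] (n : ℕ) : Subalgebra K (MvPolynomial (MatVar n) K) where
  carrier := {f | IsMatInvariant f}
  mul_mem' := fun hf hg a A B => by
    simp only [_root_.map_mul]
    rw [hf a A B, hg a A B]
  add_mem' := fun hf hg a A B => by
    simp only [_root_.map_add]
    rw [hf a A B, hg a A B]
  algebraMap_mem' := fun c a A B => by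
    simp [MvPolynomial.algebraMap_eq]

/-- The generic matrix `x`, whose entries are the corresponding polynomial variables. -/
def genX (K : Type*) [Field K] (n : ℕ) :
    Matrix (Fin n) (Fin n) (MvPolynomial (MatVar n) K) :=
  Matrix.of fun i j => MvPolynomial.X (Sum.inl (i, j))

/-- The generic matrix `y`, whose entries are the corresponding polynomial variables. -/
def genY (K : Type*) [Field K] (n : ℕ) :
    Matrix (Fin n) (Fin n) (MvPolynomial (MatVar n) K) :=
  Matrix.of fun i j => MvPolynomial.X (Sum.inr (i, j))

/-- The traces of the 17 words `x, y, x², xy, y², x³, x²y, xy², y³, x⁴, x³y, x²y², xy³, y⁴,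
xyxy, (x²y)², (y²x)²` in the generic `4 × 4` matrices `x`, `y`. -/
def hsop17 (K : Type*) [Field K] : Fin 17 → MvPolynomial (MatVar 4) K :=
  let x := genX K 4
  let y := genY K 4
  ![(x).trace, (y).trace,
    (x ^ 2).trace, (x * y).trace, (y ^ 2).trace,
    (x ^ 3).trace, (x ^ 2 * y).trace, (x * y ^ 2).trace, (y ^ 3).trace,
    (x ^ 4).trace, (x ^ 3 * y).trace, (x ^ 2 * y ^ 2).trace, (x * y ^ 3).trace,
    (y ^ 4).trace, (x * y * x * y).trace,
    ((x ^ 2 * y) ^ 2).trace, ((y ^ 2 * x) ^ 2).trace]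


section part1
theorem ch4 {k : Type*} [Field k] [CharZero k] (s : Matrix (Fin 4) (Fin 4) k)
   (h1 : s.trace = 0) (h2 : (s^2).trace = 0) (h3 : (s^3).trace = 0) (h4 : (s^4).trace = 0) : s^4 = 0 := by
  have hd : s.charpoly.natDegree = 4 := by simp [Matrix.charpoly_natDegree_eq_dim]
  have hm := s.charpoly_monic
  have hCH : s ^ 4 + (s.charpoly.coeff 3 • s^3 + s.charpoly.coeff 2 • s^2 + s.charpoly.coeff 1 • s + s.charpoly.coeff 0 • 1) = 0 := by
    have := s.aeval_self_charpoly
    rw [Polynomial.aeval_eq_sum_range, hd] at this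
    have h4 : s.charpoly.coeff 4 = 1 := by have := hm.coeff_natDegree; rwa [hd] at this
    simp only [Finset.sum_range_succ, Finset.sum_range_zero, h4] at this
    rw [← this]; simp; abel
  have hall : ∀ n, (s^(n+1)).trace = 0 := by
    intro n
    induction n using Nat.strong_induction_on with
    | _ n ih =>
      match n with
      | 0 => simpa using h1
      | 1 => simpa using h2
      | 2 => simpa using h3
      | 3 => simpa using h4
      | m+4 =>
        have e : s^(m+4+1) = -(s.charpoly.coeff 3 • s^(m+3+1) + s.charpoly.coeff 2 • s^(m+2+1) + s.charpoly.coeff 1 • s^(m+1+1) + s.charpoly.coeff 0 • s^(m+1)) := by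
          have := congrArg (fun t => s^(m+1) * t) hCH
          simp only [mul_add, mul_smul_comm, ← pow_add, mul_zero, mul_one, ← pow_succ] at this
          rw [← sub_eq_zero, ← this, sub_neg_eq_add]
        rw [e]
        simp [ih (m+3) (by omega), ih (m+2) (by omega), ih (m+1) (by omega), ih m (by omega)]
  have hpoly : ∀ r : Polynomial k, (s * Polynomial.aeval s r).trace = 0 := by
    intro r
    rw [Polynomial.aeval_eq_sum_range, Finset.mul_sum, Matrix.trace_sum]
    apply Finset.sum_eq_zero
    intro i _
    rw [mul_smul_comm, ← pow_succ', Matrix.trace_smul, hall, smul_zero]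
  obtain ⟨q, hq, hnd⟩ := Polynomial.exists_eq_pow_rootMultiplicity_mul_and_not_dvd s.charpoly hm.ne_zero 0
  rw [map_zero, sub_zero] at hq hnd
  set a := Polynomial.rootMultiplicity 0 s.charpoly
  have hcop : IsCoprime ((Polynomial.X : Polynomial k)^a) q :=
    IsCoprime.pow_left ((Polynomial.irreducible_X.coprime_iff_not_dvd).2 hnd)
  have hzero : s^a * Polynomial.aeval s q = 0 := by
    have := s.aeval_self_charpoly
    rw [hq] at this
    simpa using this
  have ha : a ≠ 0 := by
    intro h0
    rw [h0, pow_zero, one_mul] at hzero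
    have : q = Polynomial.X * q.divX + Polynomial.C (q.coeff 0) := (Polynomial.X_mul_divX_add q).symm
    rw [this] at hzero
    have h5 := congrArg Matrix.trace hzero
    simp only [map_add, map_mul, Polynomial.aeval_X, Matrix.trace_add, hpoly, Polynomial.aeval_C, Algebra.algebraMap_eq_smul_one, Matrix.trace_smul, Matrix.trace_one, Matrix.trace_zero] at h5
    simp at h5
    exact hnd (Polynomial.X_dvd_iff.2 h5)
  obtain ⟨b, c, hbc⟩ := hcop
  have hale : a ≤ 4 := by
    rw [← hd, hq]
    have hq0 : q ≠ 0 := by rintro rfl; simp at hnd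
    rw [Polynomial.natDegree_mul (pow_ne_zero _ Polynomial.X_ne_zero) hq0]
    simp
  have hid : Polynomial.aeval s (b * Polynomial.X^a) * Polynomial.aeval s (b * Polynomial.X^a) = Polynomial.aeval s (b * Polynomial.X^a) := by
    rw [← map_mul]
    have : b * Polynomial.X^a * (b * Polynomial.X^a) = b * Polynomial.X^a - b * c * s.charpoly := by
      rw [hq]; linear_combination (b * Polynomial.X^a) * hbc
    rw [this, map_sub, map_mul _ (b * c), s.aeval_self_charpoly, mul_zero, sub_zero]
  have htr : (Polynomial.aeval s (b * Polynomial.X^a)).trace = 0 := by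
    have : b * Polynomial.X^a = Polynomial.X * (b * Polynomial.X^(a-1)) := by
      conv_lhs => rw [show a = (a - 1) + 1 by omega, pow_succ]
      ring
    rw [this, map_mul, Polynomial.aeval_X, hpoly]
  have he0 : Polynomial.aeval s (b * Polynomial.X^a) = 0 := by
    have hid' : IsIdempotentElem (Matrix.toLin' (Polynomial.aeval s (b * Polynomial.X^a))) := by
      rw [IsIdempotentElem, Module.End.mul_eq_comp, ← Matrix.toLin'_mul, hid]
    have := LinearMap.IsIdempotentElem.eq_zero_of_trace_eq_zero hid' (by rw [Matrix.trace_toLin'_eq, htr])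
    exact (LinearEquiv.map_eq_zero_iff _).1 this
  have hsa : s^a = 0 := by
    have h7 : (Polynomial.X : Polynomial k)^a = Polynomial.X^a * (b * Polynomial.X^a) + c * s.charpoly := by
      rw [hq]; linear_combination (-Polynomial.X^a) * hbc
    have := congrArg (Polynomial.aeval s) h7
    rw [map_add, map_mul _ _ (b * Polynomial.X^a), map_mul _ c, he0, s.aeval_self_charpoly] at this
    simpa using this
  exact pow_eq_zero_of_le hale hsa

end part1

section part2

/-- A predicate on pairs closed under conjugation and degenerations. -/
structure DegClosed {k : Type*} [Field k] (F : Matrix (Fin 4) (Fin 4) k → Matrix (Fin 4) (Fin 4) k → Prop) : Prop where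
  zero : F 0 0
  conj : ∀ P Q A B, P * Q = 1 → F (P * A * Q) (P * B * Q) → F A B
  lim : ∀ p X Y, p * p = p → p * X * (1 - p) = 0 → p * Y * (1 - p) = 0 →
    F (p * X * p + (1 - p) * X * (1 - p)) (p * Y * p + (1 - p) * Y * (1 - p)) → F X Y

theorem DegClosed.swap {k : Type*} [Field k] {F : Matrix (Fin 4) (Fin 4) k → Matrix (Fin 4) (Fin 4) k → Prop}
    (h : DegClosed F) : DegClosed (fun A B => F B A) :=
  ⟨h.zero, fun P Q A B h1 h2 => h.conj P Q B A h1 h2, fun p X Y h0 h1 h2 h3 => h.lim p Y X h0 h2 h1 h3⟩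

def wordProd {k : Type*} [Field k] (X Y : Matrix (Fin 4) (Fin 4) k) (l : List Bool) : Matrix (Fin 4) (Fin 4) k :=
  (l.map (fun b => if b then X else Y)).prod

theorem exists_kerproj {k : Type*} [Field k] (X Y : Matrix (Fin 4) (Fin 4) k) :
    ∃ p : Matrix (Fin 4) (Fin 4) k, p * p = p ∧ X * p = X ∧ Y * p = Y ∧
      ∀ W : Matrix (Fin 4) (Fin 4) k, X * W = 0 → Y * W = 0 → p * W = 0 := by
  set Z := LinearMap.ker (Matrix.toLin' X) ⊓ LinearMap.ker (Matrix.toLin' Y) with hZ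
  obtain ⟨U, hU⟩ := Z.exists_isCompl
  set P := U.projection Z hU.symm
  have hPP : P ∘ₗ P = P := Submodule.isIdempotentElem_projection hU.symm
  have hmem : ∀ v, v - P v ∈ Z := by
    intro v
    rw [← Submodule.projection_apply_eq_zero_iff hU.symm]
    have := LinearMap.congr_fun hPP v
    simp only [LinearMap.comp_apply] at this
    change P (v - P v) = 0
    rw [map_sub, this, sub_self]
  refine ⟨LinearMap.toMatrix' P, ?_, ?_, ?_, ?_⟩
  · rw [← LinearMap.toMatrix'_comp, hPP]
  · apply Matrix.toLin'.injective
    rw [Matrix.toLin'_mul, Matrix.toLin'_toMatrix']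
    refine LinearMap.ext fun v => ?_
    have := (hmem v).1
    rw [SetLike.mem_coe, LinearMap.mem_ker, map_sub, sub_eq_zero] at this
    exact this.symm
  · apply Matrix.toLin'.injective
    rw [Matrix.toLin'_mul, Matrix.toLin'_toMatrix']
    refine LinearMap.ext fun v => ?_
    have := (hmem v).2
    rw [SetLike.mem_coe, LinearMap.mem_ker, map_sub, sub_eq_zero] at this
    exact this.symm
  · intro W h1 h2
    apply Matrix.toLin'.injective
    rw [Matrix.toLin'_mul, Matrix.toLin'_toMatrix', map_zero]
    refine LinearMap.ext fun v => ?_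
    change P _ = 0
    rw [Submodule.projection_apply_eq_zero_iff]
    constructor
    · rw [SetLike.mem_coe, LinearMap.mem_ker, ← LinearMap.comp_apply, ← Matrix.toLin'_mul, h1]; simp
    · rw [SetLike.mem_coe, LinearMap.mem_ker, ← LinearMap.comp_apply, ← Matrix.toLin'_mul, h2]; simp

theorem F_of_words {k : Type*} [Field k] {F : Matrix (Fin 4) (Fin 4) k → Matrix (Fin 4) (Fin 4) k → Prop}
    (hF : DegClosed F) (N : ℕ) : ∀ X Y, (∀ l : List Bool, l.length = N → wordProd X Y l = 0) → F X Y := by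
  induction N with
  | zero => 
    intro X Y h
    have := h [] rfl
    simp [wordProd] at this
  | succ N ih =>
    intro X Y h
    obtain ⟨p, hp, hX, hY, hW⟩ := exists_kerproj X Y
    have hX' : X * (1 - p) = 0 := by rw [mul_sub, hX, mul_one, sub_self]
    have hY' : Y * (1 - p) = 0 := by rw [mul_sub, hY, mul_one, sub_self]
    apply hF.lim p X Y hp
    · rw [mul_assoc, hX', mul_zero]
    · rw [mul_assoc, hY', mul_zero]
    rw [mul_assoc, hX, mul_assoc, hX', mul_assoc, hY, mul_assoc, hY', mul_zero, add_zero, add_zero]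
    by_cases hN : N = 0
    · subst hN
      have h1 := h [true] rfl
      have h2 := h [false] rfl
      simp [wordProd] at h1 h2
      rw [h1, h2, mul_zero]
      exact hF.zero
    apply ih
    intro l hl
    have key : ∀ l : List Bool, l ≠ [] → wordProd (p * X) (p * Y) l = p * wordProd X Y l := by
      intro l
      induction l with
      | nil => intro h; exact absurd rfl h
      | cons b l ihl =>
        intro _
        have e1 : ∀ X Y : Matrix (Fin 4) (Fin 4) k, wordProd X Y (b :: l) = (if b then X else Y) * wordProd X Y l := by
          intro X Y; simp [wordProd]
        rw [e1, e1]
        by_cases hl : l = []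
        · subst hl; cases b <;> simp [wordProd]
        · rw [ihl hl]
          cases b
          · simp only [Bool.false_eq_true, if_false]
            rw [← mul_assoc, mul_assoc p Y p, hY, mul_assoc]
          · simp only [if_true]
            rw [← mul_assoc, mul_assoc p X p, hX, mul_assoc]
    rw [key l (by rintro rfl; simp at hl; omega)]
    apply hW
    · simpa [wordProd] using h (true :: l) (by simp [hl])
    · simpa [wordProd] using h (false :: l) (by simp [hl])

end part2

section part3

section
variable {k : Type*} [Field k] {F : Matrix (Fin 4) (Fin 4) k → Matrix (Fin 4) (Fin 4) k → Prop}

theorem F_single_left (hF : DegClosed F) (X : Matrix (Fin 4) (Fin 4) k) (hX : X ^ 4 = 0) : F X 0 := by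
  apply F_of_words hF 4
  intro l hl
  by_cases h : false ∈ l
  · exact List.prod_eq_zero (by rw [List.mem_map]; exact ⟨false, h, by simp⟩)
  · have : l = List.replicate 4 true := by
      rw [List.eq_replicate_iff]
      refine ⟨hl, fun b hb => ?_⟩
      cases b
      · exact absurd hb h
      · rfl
    rw [this, ← hX]
    simp [wordProd, pow_succ, mul_assoc]

theorem F_single_right (hF : DegClosed F) (X : Matrix (Fin 4) (Fin 4) k) (hX : X ^ 4 = 0) : F 0 X :=
  F_single_left hF.swap X hX

theorem F_strict (hF : DegClosed F) (X Y : Matrix (Fin 4) (Fin 4) k)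
    (hX : ∀ i j, j ≤ i → X i j = 0) (hY : ∀ i j, j ≤ i → Y i j = 0) : F X Y := by
  apply F_of_words hF 4
  have key : ∀ l : List Bool, ∀ i j : Fin 4, (j : ℕ) < i + l.length → wordProd X Y l i j = 0 := by
    intro l
    induction l with
    | nil => intro i j h; simp [wordProd, Matrix.one_apply]; rintro rfl; simp at h
    | cons b l ih =>
      intro i j h
      have e1 : wordProd X Y (b :: l) = (if b then X else Y) * wordProd X Y l := by simp [wordProd]
      rw [e1, Matrix.mul_apply]
      apply Finset.sum_eq_zero
      intro m _
      by_cases hm : m ≤ i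
      · have : (if b then X else Y) i m = 0 := by cases b <;> simp [hX _ _ hm, hY _ _ hm]
        rw [this, zero_mul]
      · rw [ih m j, mul_zero]
        simp at h
        have : (i:ℕ) < m := by simpa using hm
        omega
  intro l hl
  ext i j
  rw [key l i j (by omega)]; rfl

theorem F_sqzero [CharZero k] (hF : DegClosed F) (X Y : Matrix (Fin 4) (Fin 4) k)
    (hX : X * X = 0) (hY : Y * Y = 0) (h1 : (X * Y).trace = 0) (h2 : (X * Y * X * Y).trace = 0)
    (h0X : X.trace = 0) (h0Y : Y.trace = 0) : F X Y := by
  have hs2 : (X + Y)^2 = X * Y + Y * X := by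
    rw [pow_two, add_mul, mul_add, mul_add, hX, hY]; abel
  have hs3 : (X + Y)^3 = X * Y * X + Y * X * Y := by
    rw [pow_succ, hs2, add_mul, mul_add, mul_add, mul_assoc X Y Y, hY, mul_assoc Y X X, hX]; simp
  have hs4 : (X + Y)^4 = X * Y * X * Y + Y * X * Y * X := by
    rw [pow_succ, hs3, add_mul, mul_add, mul_add, mul_assoc _ X X, hX, mul_assoc _ Y Y, hY]; simp
  have hnil : (X + Y)^4 = 0 := by
    apply ch4
    · rw [trace_add, h0X, h0Y, add_zero]
    · rw [hs2, trace_add, h1, trace_mul_comm, h1, add_zero]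
    · rw [hs3, trace_add, trace_mul_comm, ← mul_assoc, hX, trace_mul_comm (Y * X), ← mul_assoc, hY]; simp
    · rw [hs4, trace_add, h2, mul_assoc, mul_assoc, trace_mul_comm, ← mul_assoc, h2, add_zero]
  rw [hs4] at hnil
  have a1 : X * Y * X * Y * X = 0 := by
    have := congrArg (fun t => X * t) hnil
    simp only [mul_add, ← mul_assoc, hX] at this
    simpa using this
  have a2 : Y * X * Y * X * Y = 0 := by
    have := congrArg (fun t => Y * t) hnil
    simp only [mul_add, ← mul_assoc, hY] at this
    simpa using this
  apply F_of_words hF 5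
  intro l hl
  have hX' : ∀ Z, X * (X * Z) = 0 := fun Z => by rw [← mul_assoc, hX, zero_mul]
  have hY' : ∀ Z, Y * (Y * Z) = 0 := fun Z => by rw [← mul_assoc, hY, zero_mul]
  simp only [mul_assoc] at a1 a2
  match l, hl with
  | [a, b, c, d, e], _ =>
    cases a <;> cases b <;> cases c <;> cases d <;> cases e <;> simp [wordProd, hX', hY', hX, hY, a1, a2]

theorem bd_mul (p X Y : Matrix (Fin 4) (Fin 4) k) (hp : p * p = p) (hX : p * X * (1 - p) = 0) (hY : p * Y * (1 - p) = 0) :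
    p * (X * Y) * (1-p) = 0 ∧ (p * X * p + (1 - p) * X * (1 - p)) * (p * Y * p + (1 - p) * Y * (1 - p)) =
      p * (X * Y) * p + (1 - p) * (X * Y) * (1 - p) := by
  have e1 : p * X = p * X * p := by rw [mul_sub, mul_one, sub_eq_zero] at hX; exact hX
  have e2 : Y * (1 - p) = (1 - p) * Y * (1 - p) := by
    rw [sub_mul 1 p Y, sub_mul, one_mul, hY, sub_zero]
  have e3 : p * (1 - p) = 0 := by rw [mul_sub, hp, mul_one, sub_self]
  have e4 : (1 - p) * p = 0 := by rw [sub_mul, hp, one_mul, sub_self]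
  have e5 : (1 - p) * (1 - p) = 1 - p := by rw [mul_sub, e4, mul_one, sub_zero]
  constructor
  · rw [← mul_assoc, e1, mul_assoc, e2, mul_assoc, ← mul_assoc p (_ * _), ← mul_assoc p, e3]; simp
  · rw [add_mul, mul_add, mul_add]
    have f1 : p * X * p * (p * Y * p) = p * (X * Y) * p := by
      rw [← e1, ← mul_assoc, ← mul_assoc, ← e1]; simp only [mul_assoc]
    have f2 : p * X * p * ((1 - p) * Y * (1 - p)) = 0 := by
      rw [mul_assoc (p * X), ← mul_assoc p, ← mul_assoc p, e3]; simp
    have f3 : (1 - p) * X * (1 - p) * (p * Y * p) = 0 := by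
      rw [mul_assoc (_ * X), ← mul_assoc (1-p) (p * Y), ← mul_assoc (1-p) p, e4]; simp
    have f4 : (1 - p) * X * (1 - p) * ((1 - p) * Y * (1 - p)) = (1 - p) * (X * Y) * (1 - p) := by
      rw [← e2, mul_assoc _ (1-p), e2, ← mul_assoc (1-p), ← mul_assoc (1-p) (1-p), e5, ← e2]; simp only [mul_assoc]
    rw [f1, f2, f3, f4]; simp

theorem bd_pow (p Y : Matrix (Fin 4) (Fin 4) k) (hp : p * p = p) (hY : p * Y * (1 - p) = 0) (h4 : Y ^ 4 = 0) :
    (p * Y * p + (1 - p) * Y * (1 - p)) ^ 4 = 0 := by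
  obtain ⟨a1, a2⟩ := bd_mul p Y Y hp hY hY
  obtain ⟨b1, b2⟩ := bd_mul p (Y * Y) (Y * Y) hp a1 a1
  rw [show Y * Y * (Y * Y) = 0 by rw [← h4]; simp only [pow_succ, pow_zero, one_mul, mul_assoc]] at b2
  rw [show (p * Y * p + (1 - p) * Y * (1 - p)) ^ 4 = ((p * Y * p + (1 - p) * Y * (1 - p)) * (p * Y * p + (1 - p) * Y * (1 - p))) *
     ((p * Y * p + (1 - p) * Y * (1 - p)) * (p * Y * p + (1 - p) * Y * (1 - p))) by simp only [pow_succ, pow_zero, one_mul, mul_assoc],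
     a2, b2]; simp

theorem two_cut (hF : DegClosed F) (p q X Y : Matrix (Fin 4) (Fin 4) k) (hY : Y ^ 4 = 0) (hp : p * p = p) (hq : q * q = q)
   (h1 : p * X * (1 - p) = 0) (h2 : p * Y * (1 - p) = 0)
   (h3 : q * (p * X * p + (1 - p) * X * (1 - p)) * (1 - q) = 0) (h4 : q * (p * Y * p + (1 - p) * Y * (1 - p)) * (1 - q) = 0)
   (h5 : q * (p * X * p + (1 - p) * X * (1 - p)) * q + (1 - q) * (p * X * p + (1 - p) * X * (1 - p)) * (1 - q) = 0) : F X Y := by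
  apply hF.lim p X Y hp h1 h2
  apply hF.lim q _ _ hq h3 h4
  rw [h5]
  exact F_single_right hF _ (bd_pow q _ hq h4 (bd_pow p _ hp h2 hY))
end

end part3

section part4

structure TC {k : Type*} [Field k] (X Y : Matrix (Fin 4) (Fin 4) k) : Prop where
  hx : X ^ 4 = 0
  hy : Y ^ 4 = 0
  tx : X.trace = 0
  ty : Y.trace = 0
  t11 : (X * Y).trace = 0
  t21 : (X ^ 2 * Y).trace = 0
  t12 : (X * Y ^ 2).trace = 0
  t31 : (X ^ 3 * Y).trace = 0
  t22 : (X ^ 2 * Y ^ 2).trace = 0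
  t13 : (X * Y ^ 3).trace = 0
  t1111 : (X * Y * X * Y).trace = 0
  t42 : ((X ^ 2 * Y) ^ 2).trace = 0
  t24 : ((Y ^ 2 * X) ^ 2).trace = 0

theorem TC.swap {k : Type*} [Field k] {X Y : Matrix (Fin 4) (Fin 4) k} (h : TC X Y) : TC Y X where
  hx := h.hy
  hy := h.hx
  tx := h.ty
  ty := h.tx
  t11 := by rw [trace_mul_comm, h.t11]
  t21 := by rw [trace_mul_comm, h.t12]
  t12 := by rw [trace_mul_comm, h.t21]
  t31 := by rw [trace_mul_comm, h.t13]
  t22 := by rw [trace_mul_comm, h.t22]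
  t13 := by rw [trace_mul_comm, h.t31]
  t1111 := by rw [trace_mul_comm, ← mul_assoc, ← mul_assoc, h.t1111]
  t42 := h.t24
  t24 := h.t42

theorem TC.conj {k : Type*} [Field k] {X Y : Matrix (Fin 4) (Fin 4) k} (h : TC X Y) (P Q : Matrix (Fin 4) (Fin 4) k)
    (hPQ : P * Q = 1) : TC (P * X * Q) (P * Y * Q) := by
  have hQP : Q * P = 1 := mul_eq_one_comm.1 hPQ
  let φ : Matrix (Fin 4) (Fin 4) k →*₀ Matrix (Fin 4) (Fin 4) k :=
    { toFun := fun M => P * M * Q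
      map_zero' := by simp
      map_one' := by simp [hPQ]
      map_mul' := fun M N => by
        simp only [mul_assoc]; rw [← mul_assoc Q P, hQP, one_mul] }
  have ht : ∀ M, (φ M).trace = M.trace := fun M => by
    change (P * M * Q).trace = _
    rw [trace_mul_comm, ← mul_assoc, hQP, one_mul]
  change TC (φ X) (φ Y)
  constructor <;> simp only [← map_mul, ← map_pow, ht]
  · rw [h.hx, map_zero]
  · rw [h.hy, map_zero]
  · exact h.tx
  · exact h.ty
  · exact h.t11
  · exact h.t21
  · exact h.t12
  · exact h.t31
  · exact h.t22
  · exact h.t13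
  · exact h.t1111
  · exact h.t42
  · exact h.t24

section
variable {k : Type*} [Field k] [CharZero k] {F : Matrix (Fin 4) (Fin 4) k → Matrix (Fin 4) (Fin 4) k → Prop}

theorem F_J4 (hF : DegClosed F) (Y : Matrix (Fin 4) (Fin 4) k)
    (h : TC !![0,1,0,0; 0,0,1,0; 0,0,0,1; 0,0,0,0] Y) : F !![0,1,0,0; 0,0,1,0; 0,0,0,1; 0,0,0,0] Y := by
  have h11 := h.t11
  have h21 := h.t21
  have h31 := h.t31
  have h22 := h.t22
  have h1111 := h.t1111
  have h42 := h.t42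
  have hy := h.hy
  simp [pow_succ, Matrix.mul_apply, Matrix.trace, Fin.sum_univ_four, Matrix.vecMul, dotProduct] at h11 h21 h31 h22 h1111 h42
  rw [h31] at h42 h22 h1111
  have e1 : Y 3 1 = - Y 2 0 := by linear_combination h21
  have z20 : Y 2 0 = 0 := by
    rw [e1] at h42
    have : (2:k) * Y 2 0 ^ 2 = 0 := by linear_combination h42
    simpa using this
  rw [z20, neg_zero] at e1
  rw [z20, e1] at h22 h1111
  have z21 : Y 2 1 = 0 := by
    have : Y 2 1 ^ 2 = 0 := by linear_combination Y 2 1 * h11 - h22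
    simpa using this
  have z10 : Y 1 0 = 0 := by
    rw [z21] at h11 h1111
    have : (2:k) * Y 1 0 ^ 2 = 0 := by linear_combination h1111 + (Y 1 0 - Y 3 2) * h11
    simpa using this
  have z32 : Y 3 2 = 0 := by
    rw [z21, z10] at h11; simpa using h11
  have d0 := congrFun (congrFun hy 0) 0
  have d1 := congrFun (congrFun hy 1) 1
  have d2 := congrFun (congrFun hy 2) 2
  have d3 := congrFun (congrFun hy 3) 3
  simp [pow_succ, Matrix.mul_apply, Fin.sum_univ_four, h31, e1, z20, z21, z10, z32] at d0 d1 d2 d3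
  apply F_strict hF
  · intro i j; fin_cases i <;> fin_cases j <;> simp
  · intro i j; fin_cases i <;> fin_cases j <;> simp [*]

theorem F_J31 (hF : DegClosed F) (Y : Matrix (Fin 4) (Fin 4) k)
    (h : TC !![0,1,0,0; 0,0,1,0; 0,0,0,0; 0,0,0,0] Y) : F !![0,1,0,0; 0,0,1,0; 0,0,0,0; 0,0,0,0] Y := by
  have h11 := h.t11
  have h21 := h.t21
  have h12 := h.t12
  have h22 := h.t22
  have h1111 := h.t1111
  have hy := h.hy
  simp [pow_succ, Matrix.mul_apply, Matrix.trace, Fin.sum_univ_four, Matrix.vecMul, dotProduct] at h11 h21 h12 h22 h1111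
  rw [h21] at h12 h22 h1111
  have e1 : Y 2 1 = - Y 1 0 := by linear_combination h11
  have z10 : Y 1 0 = 0 := by
    rw [e1] at h1111
    have : (2:k) * Y 1 0 ^ 2 = 0 := by linear_combination h1111
    simpa using this
  rw [z10, neg_zero] at e1
  rw [z10, e1] at h12 h22
  simp at h12 h22
  have E : ∀ a b c d : k, (1 : Matrix (Fin 4) (Fin 4) k) - diagonal ![a,b,c,d] = diagonal ![1-a,1-b,1-c,1-d] := by
    intro a b c d
    ext i j; fin_cases i <;> fin_cases j <;> simp
  by_cases z23 : Y 2 3 = 0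
  · rw [z23] at h12
    simp at h12
    by_cases z30 : Y 3 0 = 0
    · apply two_cut hF (diagonal ![0,1,1,1]) (diagonal ![0,0,1,0]) _ _ hy <;> rw [← sub_eq_zero] <;> ext i j <;>
      fin_cases i <;> fin_cases j <;> simp [E, *]
    · have z13 := h12.resolve_right z30
      apply two_cut hF (diagonal ![0,1,1,0]) (diagonal ![0,0,1,0]) _ _ hy <;> rw [← sub_eq_zero] <;> ext i j <;>
      fin_cases i <;> fin_cases j <;> simp [E, *]
  · have z30 := h22.resolve_left z23
    rw [z30] at h12
    simp [z23] at h12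
    apply two_cut hF (diagonal ![0,0,1,1]) (diagonal ![0,1,1,1]) _ _ hy <;> rw [← sub_eq_zero] <;> ext i j <;>
      fin_cases i <;> fin_cases j <;> simp [E, *]
theorem nullcone_of_sq_ne (hF : DegClosed F) (X Y : Matrix (Fin 4) (Fin 4) k) (h : TC X Y) (h2 : X ^ 2 ≠ 0) : F X Y := by
  have hx := h.hx
  have red : ∀ (J g : Matrix (Fin 4) (Fin 4) k), (∀ c, g *ᵥ c = 0 → c = 0) → X * g = g * J → 
      (∀ Z, TC J Z → F J Z) → F X Y := by
    intro J g hg hXg hJ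
    have hu : IsUnit g := by
      rw [← Matrix.mulVec_injective_iff_isUnit]
      intro a b hab
      rw [← sub_eq_zero]
      exact hg _ (by rw [Matrix.mulVec_sub, sub_eq_zero]; exact hab)
    obtain ⟨u, rfl⟩ := hu
    have hPQ : (↑u⁻¹ : Matrix (Fin 4) (Fin 4) k) * u = 1 := by simp
    have hXJ : (↑u⁻¹ : Matrix (Fin 4) (Fin 4) k) * X * u = J := by
      rw [mul_assoc, hXg, ← mul_assoc, hPQ, one_mul]
    apply hF.conj _ _ _ _ hPQ
    have := h.conj _ _ hPQ
    rw [hXJ] at this ⊢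
    exact hJ _ this
  by_cases h3 : X ^ 3 = 0
  · obtain ⟨v, hv⟩ : ∃ v, X ^ 2 *ᵥ v ≠ 0 := by
      by_contra! hc
      exact h2 (Matrix.ext_of_mulVec_single fun i => by rw [hc, Matrix.zero_mulVec])
    have x1 : X *ᵥ (X *ᵥ v) = X ^ 2 *ᵥ v := by rw [mulVec_mulVec, pow_two]
    have x2 : X *ᵥ (X ^ 2 *ᵥ v) = 0 := by rw [mulVec_mulVec, ← pow_succ', h3, zero_mulVec]
    obtain ⟨w, hw0, hw⟩ : ∃ w, X *ᵥ w = 0 ∧ ∀ a b : k, a • (X ^ 2 *ᵥ v) + b • w = 0 → b = 0 := by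
      by_contra! hc
      have key : ∀ w, X *ᵥ w = 0 → ∃ a : k, w = a • (X ^ 2 *ᵥ v) := by
        intro w hw
        obtain ⟨a, b, hab, hb⟩ := hc w hw
        refine ⟨-(b⁻¹ * a), ?_⟩
        have h1 : b • w = - (a • (X ^ 2 *ᵥ v)) := by
          rw [eq_neg_iff_add_eq_zero, add_comm]; exact hab
        rw [neg_smul, mul_smul, ← smul_neg, ← h1, smul_smul, inv_mul_cancel₀ hb, one_smul]
      have hspan : (⊤ : Submodule k (Fin 4 → k)) ≤ Submodule.span k (Set.range ![X ^ 2 *ᵥ v, X *ᵥ v, v]) := by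
        intro u _
        obtain ⟨a, ha⟩ := key (X ^ 2 *ᵥ u) (by rw [mulVec_mulVec, ← pow_succ', h3, zero_mulVec])
        obtain ⟨b, hb⟩ := key (X *ᵥ (u - a • v)) (by
          rw [mulVec_mulVec, ← pow_two, mulVec_sub, mulVec_smul, ← ha, sub_self])
        obtain ⟨c, hc⟩ := key (u - a • v - b • (X *ᵥ v)) (by
          rw [mulVec_sub, hb, mulVec_smul, x1, sub_self])
        have hu : u = a • v + b • (X *ᵥ v) + c • (X ^ 2 *ᵥ v) := by rw [← hc]; abel
        rw [hu]
        have m : ∀ i, ![X ^ 2 *ᵥ v, X *ᵥ v, v] i ∈ Submodule.span k (Set.range ![X ^ 2 *ᵥ v, X *ᵥ v, v]) :=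
          fun i => Submodule.subset_span ⟨i, rfl⟩
        exact Submodule.add_mem _ (Submodule.add_mem _ (Submodule.smul_mem _ _ (m 2)) (Submodule.smul_mem _ _ (m 1)))
          (Submodule.smul_mem _ _ (m 0))
      have h1 := finrank_range_le_card (R := k) ![X ^ 2 *ᵥ v, X *ᵥ v, v]
      rw [Set.finrank, top_le_iff.1 hspan] at h1
      simp at h1
    apply red _ (Matrix.of ![X ^ 2 *ᵥ v, X *ᵥ v, v, w])ᵀ _ _ (F_J31 hF)
    · intro c hc
      have hc' : c 0 • (X ^ 2 *ᵥ v) + c 1 • (X *ᵥ v) + c 2 • v + c 3 • w = 0 := by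
        rw [← hc]; ext i
        simp [Matrix.mulVec, dotProduct, Fin.sum_univ_four, mul_comm]
      have h1 := congrArg (fun u => X *ᵥ u) hc'
      simp only [mulVec_add, mulVec_smul, x1, x2, hw0, smul_zero, mulVec_zero, zero_add, add_zero] at h1
      have h4 := congrArg (fun u => X *ᵥ u) h1
      simp only [mulVec_add, mulVec_smul, x1, x2, hw0, smul_zero, mulVec_zero, zero_add, add_zero] at h4
      have c2 := (smul_eq_zero.1 h4).resolve_right hv
      rw [c2, zero_smul, add_zero] at h1 hc'
      have c1 := (smul_eq_zero.1 h1).resolve_right hv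
      rw [c1, zero_smul, add_zero] at hc'
      have c3 := hw _ _ hc'
      rw [c3, zero_smul, add_zero] at hc'
      have c0 := (smul_eq_zero.1 hc').resolve_right hv
      ext i; fin_cases i <;> simp [*]
    · ext i j
      have e : (X * (Matrix.of ![X ^ 2 *ᵥ v, X *ᵥ v, v, w])ᵀ) i j = (X *ᵥ (![X ^ 2 *ᵥ v, X *ᵥ v, v, w] j)) i := rfl
      rw [e]
      fin_cases j <;> simp [x1, x2, hw0, Matrix.mul_apply, Fin.sum_univ_four]
  · obtain ⟨v, hv⟩ : ∃ v, X ^ 3 *ᵥ v ≠ 0 := by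
      by_contra! hc
      exact h3 (Matrix.ext_of_mulVec_single fun i => by rw [hc, Matrix.zero_mulVec])
    have x1 : X *ᵥ (X *ᵥ v) = X ^ 2 *ᵥ v := by rw [mulVec_mulVec, pow_two]
    have x2 : X *ᵥ (X ^ 2 *ᵥ v) = X ^ 3 *ᵥ v := by rw [mulVec_mulVec, ← pow_succ']
    have x3 : X *ᵥ (X ^ 3 *ᵥ v) = 0 := by rw [mulVec_mulVec, ← pow_succ', hx, zero_mulVec]
    apply red _ (Matrix.of ![X ^ 3 *ᵥ v, X ^ 2 *ᵥ v, X *ᵥ v, v])ᵀ _ _ (F_J4 hF)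
    · intro c hc
      have hc' : c 0 • (X ^ 3 *ᵥ v) + c 1 • (X ^ 2 *ᵥ v) + c 2 • (X *ᵥ v) + c 3 • v = 0 := by
        rw [← hc]; ext i
        simp [Matrix.mulVec, dotProduct, Fin.sum_univ_four, mul_comm]
      have h1 := congrArg (fun u => X *ᵥ u) hc'
      simp only [mulVec_add, mulVec_smul, x1, x2, x3, smul_zero, mulVec_zero, zero_add, add_zero] at h1
      have h4 := congrArg (fun u => X *ᵥ u) h1
      simp only [mulVec_add, mulVec_smul, x1, x2, x3, smul_zero, mulVec_zero, zero_add, add_zero] at h4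
      have h5 := congrArg (fun u => X *ᵥ u) h4
      simp only [mulVec_add, mulVec_smul, x1, x2, x3, smul_zero, mulVec_zero, zero_add, add_zero] at h5
      have c3 := (smul_eq_zero.1 h5).resolve_right hv
      rw [c3, zero_smul, add_zero] at h4 h1 hc'
      have c2 := (smul_eq_zero.1 h4).resolve_right hv
      rw [c2, zero_smul, add_zero] at h1 hc'
      have c1 := (smul_eq_zero.1 h1).resolve_right hv
      rw [c1, zero_smul, add_zero] at hc'
      have c0 := (smul_eq_zero.1 hc').resolve_right hv
      ext i; fin_cases i <;> simp [*]
    · ext i j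
      have e : (X * (Matrix.of ![X ^ 3 *ᵥ v, X ^ 2 *ᵥ v, X *ᵥ v, v])ᵀ) i j = (X *ᵥ (![X ^ 3 *ᵥ v, X ^ 2 *ᵥ v, X *ᵥ v, v] j)) i := rfl
      rw [e]
      fin_cases j <;> simp [x1, x2, x3, Matrix.mul_apply, Fin.sum_univ_four]

theorem nullcone (hF : DegClosed F) (X Y : Matrix (Fin 4) (Fin 4) k) (h : TC X Y) : F X Y := by
  by_cases hX : X ^ 2 = 0
  · by_cases hY : Y ^ 2 = 0
    · rw [pow_two] at hX hY
      exact F_sqzero hF X Y hX hY h.t11 h.t1111 h.tx h.ty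
    · exact nullcone_of_sq_ne hF.swap Y X h.swap hY
  · exact nullcone_of_sq_ne hF X Y h hX
end

end part4

section part5

theorem krull_integral {R S : Type*} [CommRing R] [CommRing S] [Algebra R S] [Algebra.IsIntegral R S]
    (hinj : Function.Injective (algebraMap R S)) : ringKrullDim S = ringKrullDim R := by
  apply le_antisymm
  · apply Order.krullDim_le_of_strictMono (PrimeSpectrum.comap (algebraMap R S))
    intro I J hIJ
    exact Ideal.IsIntegral.comap_lt_comap (R := R) (show I.asIdeal < J.asIdeal from hIJ)
  · apply iSup_le
    intro l
    obtain ⟨Q, _, hQ, hQ2⟩ := Ideal.exists_ideal_over_prime_of_isIntegral (S := S) l.head.asIdeal ⊥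
      (by rw [← RingHom.ker_eq_comap_bot, (RingHom.injective_iff_ker_eq_bot _).1 hinj]; exact bot_le)
    have : Q.LiesOver l.head.asIdeal := ⟨hQ2.symm⟩
    obtain ⟨L, hL, -⟩ := Ideal.exists_ltSeries_of_hasGoingUp l Q
    rw [← hL]
    exact Order.LTSeries.length_le_krullDim L

theorem krull_of_fin {K R : Type*} [Field K] [CommRing R] [Algebra K R] (C : Subalgebra K R) (n : ℕ)
    (h : Fin n → R) (hC : ∀ i, h i ∈ C) (hind : AlgebraicIndependent K h)
    (m : ℕ) (Q : Fin m → R) (hQ : ∀ j, Q j ∈ C)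
    (hf : ∀ f ∈ C, ∃ c : Fin m → R,
        (∀ j, c j ∈ Algebra.adjoin K (Set.range h)) ∧ f = ∑ j, c j * Q j) :
    ringKrullDim C = n := by
  let φ : MvPolynomial (Fin n) K →ₐ[K] C := MvPolynomial.aeval fun i => ⟨h i, hC i⟩
  have hφ : ∀ p, ((φ p : C) : R) = MvPolynomial.aeval h p := by
    intro p
    change C.val (φ p) = _
    rw [← AlgHom.comp_apply]
    congr 1
    apply MvPolynomial.algHom_ext
    intro i; simp [φ]
  let : Algebra (MvPolynomial (Fin n) K) C := φ.toRingHom.toAlgebra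
  have hinj : Function.Injective (algebraMap (MvPolynomial (Fin n) K) C) := by
    intro p q hpq
    apply hind
    change φ p = φ q at hpq
    rw [← hφ, ← hφ, hpq]
  have : Module.Finite (MvPolynomial (Fin n) K) C := by
    constructor
    rw [Submodule.fg_def]
    refine ⟨Set.range fun j => (⟨Q j, hQ j⟩ : C), Set.finite_range _, ?_⟩
    rw [eq_top_iff]
    rintro ⟨f, hfC⟩ -
    obtain ⟨c, hc, hfc⟩ := hf f hfC
    rw [Algebra.adjoin_range_eq_range_aeval] at hc
    choose p hp using hc
    have : (⟨f, hfC⟩ : C) = ∑ j, p j • (⟨Q j, hQ j⟩ : C) := by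
      apply Subtype.ext
      refine hfc.trans ?_
      simp only [AddSubmonoidClass.coe_finset_sum]
      apply Finset.sum_congr rfl
      intro j _
      rw [Algebra.smul_def, ← hp]
      change _ = ((φ (p j) : C) : R) * _
      rw [hφ]
      rfl
    rw [this]
    exact Submodule.sum_mem _ fun j _ => Submodule.smul_mem _ _ (Submodule.subset_span ⟨j, rfl⟩)
  rw [krull_integral hinj, MvPolynomial.ringKrullDim_of_isNoetherianRing]
  simp

end part5

section part6

theorem ev_genX {K L : Type*} [Field K] [CommRing L] [Algebra K L] {n : ℕ} (A B : Matrix (Fin n) (Fin n) L) :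
    (aeval (R := K) (pairSub A B)).mapMatrix (genX K n) = A := by
  ext i j
  simp [genX, pairSub]

theorem ev_genY {K L : Type*} [Field K] [CommRing L] [Algebra K L] {n : ℕ} (A B : Matrix (Fin n) (Fin n) L) :
    (aeval (R := K) (pairSub A B)).mapMatrix (genY K n) = B := by
  ext i j
  simp [genY, pairSub]

theorem ev_trace {K L : Type*} [Field K] [CommRing L] [Algebra K L] {n : ℕ} (A B : Matrix (Fin n) (Fin n) L)
    (M : Matrix (Fin n) (Fin n) (MvPolynomial (MatVar n) K)) :
    aeval (R := K) (pairSub A B) M.trace = ((aeval (R := K) (pairSub A B)).mapMatrix M).trace := by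
  simp [Matrix.trace]

def trs {L : Type*} [CommRing L] (x y : Matrix (Fin 4) (Fin 4) L) : Fin 17 → L :=
  ![(x).trace, (y).trace,
    (x ^ 2).trace, (x * y).trace, (y ^ 2).trace,
    (x ^ 3).trace, (x ^ 2 * y).trace, (x * y ^ 2).trace, (y ^ 3).trace,
    (x ^ 4).trace, (x ^ 3 * y).trace, (x ^ 2 * y ^ 2).trace, (x * y ^ 3).trace,
    (y ^ 4).trace, (x * y * x * y).trace,
    ((x ^ 2 * y) ^ 2).trace, ((y ^ 2 * x) ^ 2).trace]

theorem ev_hsop {K L : Type*} [Field K] [CommRing L] [Algebra K L] (A B : Matrix (Fin 4) (Fin 4) L) (i : Fin 17) :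
    aeval (R := K) (pairSub A B) (hsop17 K i) = trs A B i := by
  fin_cases i <;>
  simp only [hsop17, trs, ev_trace, _root_.map_mul, _root_.map_pow, ev_genX, ev_genY, Fin.mk_zero, Fin.reduceFinMk,
    Matrix.cons_val, Fin.mk_one]

theorem trs_conj {L : Type*} [CommRing L] (P Q A B : Matrix (Fin 4) (Fin 4) L) (hPQ : P * Q = 1) (i : Fin 17) :
    trs (P * A * Q) (P * B * Q) i = trs A B i := by
  have hQP : Q * P = 1 := mul_eq_one_comm.1 hPQ
  let φ : Matrix (Fin 4) (Fin 4) L →*₀ Matrix (Fin 4) (Fin 4) L :=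
    { toFun := fun M => P * M * Q
      map_zero' := by simp
      map_one' := by simp [hPQ]
      map_mul' := fun M N => by
        simp only [mul_assoc]; rw [← mul_assoc Q P, hQP, one_mul] }
  have ht : ∀ M, (φ M).trace = M.trace := fun M => by
    change (P * M * Q).trace = _
    rw [trace_mul_comm, ← mul_assoc, hQP, one_mul]
  change trs (φ A) (φ B) i = _
  simp only [trs, ← _root_.map_mul, ← _root_.map_pow, ht]

theorem hsop_inv {K : Type*} [Field K] (i : Fin 17) : hsop17 K i ∈ pureAlg K 4 := by
  intro a A B
  have h := fun A B => ev_hsop (K := K) (L := K) A B i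
  simp only [aeval_eq_eval] at h
  change eval _ _ = eval _ _ 
  erw [h, h]
  exact trs_conj _ _ _ _ (by simp) i

def MH {K : Type*} [Field K] (M : Matrix (Fin 4) (Fin 4) (MvPolynomial (MatVar 4) K)) (d : ℕ) : Prop :=
  ∀ i j, (M i j).IsHomogeneous d

theorem MH.mul {K : Type*} [Field K] {M N : Matrix (Fin 4) (Fin 4) (MvPolynomial (MatVar 4) K)} {d e : ℕ} 
    (hM : MH M d) (hN : MH N e) : MH (M * N) (d + e) := fun i j => by
  rw [Matrix.mul_apply]
  exact IsHomogeneous.sum _ _ _ fun k _ => (hM i k).mul (hN k j)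

theorem MH.pow {K : Type*} [Field K] {M : Matrix (Fin 4) (Fin 4) (MvPolynomial (MatVar 4) K)} {d : ℕ} 
    (hM : MH M d) (n : ℕ) : MH (M ^ n) (d * n) := by
  induction n with
  | zero => 
    intro i j
    rw [pow_zero, mul_zero, Matrix.one_apply]
    split_ifs
    · exact isHomogeneous_one _ _
    · exact isHomogeneous_zero _ _ _
  | succ n ih => rw [pow_succ]; exact ih.mul hM

theorem MH.tr {K : Type*} [Field K] {M : Matrix (Fin 4) (Fin 4) (MvPolynomial (MatVar 4) K)} {d : ℕ} 
    (hM : MH M d) : M.trace.IsHomogeneous d :=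
  IsHomogeneous.sum _ _ _ fun k _ => hM k k

def hdeg : Fin 17 → ℕ := ![1,1,2,2,2,3,3,3,3,4,4,4,4,4,4,6,6]

theorem hdeg_pos (i : Fin 17) : 0 < hdeg i := by
  fin_cases i <;> decide

theorem hsop_homog {K : Type*} [Field K] (i : Fin 17) : (hsop17 K i).IsHomogeneous (hdeg i) := by
  have hx : MH (genX K 4) 1 := fun i j => isHomogeneous_X _ _
  have hy : MH (genY K 4) 1 := fun i j => isHomogeneous_X _ _
  fin_cases i
  · exact hx.tr
  · exact hy.tr
  · exact (hx.pow 2).tr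
  · exact (hx.mul hy).tr
  · exact (hy.pow 2).tr
  · exact (hx.pow 3).tr
  · exact ((hx.pow 2).mul hy).tr
  · exact (hx.mul (hy.pow 2)).tr
  · exact (hy.pow 3).tr
  · exact (hx.pow 4).tr
  · exact ((hx.pow 3).mul hy).tr
  · exact ((hx.pow 2).mul (hy.pow 2)).tr
  · exact (hx.mul (hy.pow 3)).tr
  · exact (hy.pow 4).tr
  · exact (((hx.mul hy).mul hx).mul hy).tr
  · exact (((hx.pow 2).mul hy).pow 2).tr
  · exact (((hy.pow 2).mul hx).pow 2).tr

end part6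

section part7

abbrev Mat4 (L : Type*) := Matrix (Fin 4) (Fin 4) L
abbrev PR (K : Type*) [Field K] := MvPolynomial (MatVar 4) K

theorem homog_scale {σ K L : Type*} [CommSemiring K] [CommRing L] [Algebra K L] [Fintype σ]
    {f : MvPolynomial σ K} {d : ℕ} (hf : f.IsHomogeneous d) (c : L) (v : σ → L) :
    aeval (fun i => c * v i) f = c ^ d * aeval v f := by
  rw [aeval_def, eval₂_eq', aeval_def, eval₂_eq', Finset.mul_sum]
  apply Finset.sum_congr rfl
  intro m hm
  have h := hf (mem_support_iff.1 hm)
  rw [Finsupp.weight_apply, Finsupp.sum_fintype _ _ (by simp)] at h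
  simp only [Pi.one_apply, smul_eq_mul, mul_one] at h
  simp only [mul_pow, Finset.prod_mul_distrib]
  rw [Finset.prod_pow_eq_pow_sum, h]
  ring

theorem pairSub_smul {L : Type*} [CommRing L] (c : L) (A B : Mat4 L) :
    pairSub (c • A) (c • B) = fun i => c * pairSub A B i := by
  funext i
  rcases i with i | i <;> simp [pairSub]

theorem ev_nat {K L M : Type*} [Field K] [CommRing L] [CommRing M] [Algebra K L] [Algebra K M] (φ : L →ₐ[K] M)
    (A B : Mat4 L) (f : PR K) :
    φ (aeval (pairSub A B) f) = aeval (pairSub (φ.mapMatrix A) (φ.mapMatrix B)) f := by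
  rw [← AlgHom.comp_apply]
  congr 1
  apply algHom_ext
  intro i
  rcases i with i | i <;> simp [pairSub]

theorem ev_gen {K : Type*} [Field K] (f : PR K) : aeval (pairSub (genX K 4) (genY K 4)) f = f := by
  have : pairSub (genX K 4) (genY K 4) = X := by
    funext i; rcases i with i | i <;> simp [pairSub, genX, genY]
  rw [this]; simp

theorem inv_comp {K : Type*} [Field K] [CharZero K] {f : PR K} (hf : f ∈ pureAlg K 4) (d : ℕ) :
    homogeneousComponent d f ∈ pureAlg K 4 := by
  intro a A B
  set A' := (a : Mat4 K) * A * ((a⁻¹ : GL (Fin 4) K) : Mat4 K) with hA'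
  set B' := (a : Mat4 K) * B * ((a⁻¹ : GL (Fin 4) K) : Mat4 K) with hB'
  have key : ∀ (A B : Mat4 K) (t : K), eval (pairSub (t • A) (t • B)) f = 
      (∑ e ∈ Finset.range (f.totalDegree + 1), Polynomial.C (eval (pairSub A B) (homogeneousComponent e f)) * Polynomial.X ^ e : Polynomial K).eval t := by
    intro A B t
    conv_lhs => rw [← sum_homogeneousComponent f]
    rw [_root_.map_sum, Polynomial.eval_finsetSum]
    apply Finset.sum_congr rfl
    intro e _
    have := homog_scale (homogeneousComponent_isHomogeneous e f) t (pairSub A B)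
    rw [pairSub_smul]
    simp only [aeval_eq_eval] at this
    erw [this]
    rw [Polynomial.eval_mul, Polynomial.eval_C, Polynomial.eval_pow, Polynomial.eval_X, mul_comm]
  have hp : (∑ e ∈ Finset.range (f.totalDegree + 1), Polynomial.C (eval (pairSub A' B') (homogeneousComponent e f)) * Polynomial.X ^ e : Polynomial K)
    = (∑ e ∈ Finset.range (f.totalDegree + 1), Polynomial.C (eval (pairSub A B) (homogeneousComponent e f)) * Polynomial.X ^ e : Polynomial K) := by
    apply Polynomial.funext
    intro t
    rw [← key, ← key, ← hf a (t • A) (t • B)]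
    simp [hA', hB']
  by_cases hd : d ∈ Finset.range (f.totalDegree + 1)
  · have := congrArg (fun p => Polynomial.coeff p d) hp
    simpa [Polynomial.finsetSum_coeff, Polynomial.coeff_X_pow, Finset.mem_range.1 hd] using this
  · rw [homogeneousComponent_eq_zero]
    · simp
    · simpa using hd

abbrev UR (K : Type*) [Field K] := MvPolynomial ((Fin 4 × Fin 4) ⊕ MatVar 4) K
noncomputable def uZ (K : Type*) [Field K] : Mat4 (UR K) := Matrix.of fun i j => MvPolynomial.X (Sum.inl (i, j))
noncomputable def uX (K : Type*) [Field K] : Mat4 (UR K) := Matrix.of fun i j => MvPolynomial.X (Sum.inr (Sum.inl (i, j)))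
noncomputable def uY (K : Type*) [Field K] : Mat4 (UR K) := Matrix.of fun i j => MvPolynomial.X (Sum.inr (Sum.inr (i, j)))

theorem usp {K M : Type*} [Field K] [CommRing M] [Algebra K M] (z A B : Mat4 M) :
      ∃ φ : UR K →ₐ[K] M, φ.mapMatrix (uZ K) = z ∧ φ.mapMatrix (uX K) = A ∧ φ.mapMatrix (uY K) = B := by
  refine ⟨aeval (Sum.elim (fun ij => z ij.1 ij.2) (pairSub A B)), ?_, ?_, ?_⟩ <;> ext i j <;>
      simp [uX, uY, uZ, pairSub]

theorem adj_conj {K : Type*} [Field K] [CharZero K] {f : PR K} {d : ℕ} (hf : f ∈ pureAlg K 4) (hd : f.IsHomogeneous d)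
    {L : Type*} [CommRing L] [Algebra K L] (z A B : Mat4 L) :
    aeval (pairSub (z * A * z.adjugate) (z * B * z.adjugate)) f = z.det ^ d * aeval (pairSub A B) f := by
  -- field case
  have h1 : ∀ z A B : Mat4 K, z.det ≠ 0 → 
      aeval (pairSub (z * A * z.adjugate) (z * B * z.adjugate)) f = z.det ^ d * aeval (pairSub A B) f := by
    intro z A B hz
    let a : GL (Fin 4) K := GeneralLinearGroup.mkOfDetNeZero z hz
    have ha : (a : Mat4 K) = z := rfl
    have hai : z.adjugate = z.det • ((a⁻¹ : GL (Fin 4) K) : Mat4 K) := by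
      have : z * ((a⁻¹ : GL (Fin 4) K) : Mat4 K) = 1 := by rw [← ha]; simp
      calc z.adjugate = z.adjugate * (z * ((a⁻¹ : GL (Fin 4) K) : Mat4 K)) := by rw [this, mul_one]
        _ = _ := by rw [← mul_assoc, adjugate_mul]; simp
    have h := hf a A B
    rw [ha] at h
    rw [hai, Matrix.mul_smul, Matrix.mul_smul, pairSub_smul, homog_scale hd]
    congr 1
  let Z := uZ K
  let Xg := uX K
  let Yg := uY K
  have main : aeval (pairSub (Z * Xg * Z.adjugate) (Z * Yg * Z.adjugate)) f = Z.det ^ d * aeval (pairSub Xg Yg) f := by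
    have hdet : Z.det ≠ 0 := by
      intro h0
      obtain ⟨φ, h1, -, -⟩ := usp (K := K) (1 : Mat4 K) 0 0
      have := congrArg φ h0
      rw [AlgHom.map_det, h1] at this
      simp at this
    apply mul_left_cancel₀ hdet
    apply MvPolynomial.funext
    intro v
    rw [← aeval_eq_eval]
    set φ := aeval (R := K) v
    change φ _ = φ _
    simp only [_root_.map_mul, _root_.map_pow, ev_nat, AlgHom.map_det]
    rw [AlgHom.map_adjugate]
    by_cases hz : (φ.mapMatrix Z).det = 0
    · rw [hz]; simp
    · rw [h1 _ _ _ hz]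
  obtain ⟨φ, h1, h2, h3⟩ := usp (K := K) z A B
  have := congrArg φ main
  simp only [_root_.map_mul, _root_.map_pow, ev_nat, AlgHom.map_det] at this
  rw [AlgHom.map_adjugate, h1, h2, h3] at this
  exact this

theorem conj_ext {K : Type*} [Field K] [CharZero K] {f : PR K} {d : ℕ} (hf : f ∈ pureAlg K 4) (hd : f.IsHomogeneous d)
    {L : Type*} [Field L] [Algebra K L] (P Q A B : Mat4 L) (hPQ : P * Q = 1) :
    aeval (pairSub (P * A * Q) (P * B * Q)) f = aeval (pairSub A B) f := by
  have h := adj_conj hf hd P A B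
  have hai : P.adjugate = P.det • Q := by
    calc P.adjugate = P.adjugate * (P * Q) := by rw [hPQ, mul_one]
        _ = _ := by rw [← mul_assoc, adjugate_mul]; simp
  rw [hai, Matrix.mul_smul, Matrix.mul_smul, pairSub_smul, homog_scale hd] at h
  have hdet : P.det ≠ 0 := by
    intro h0
    have := congrArg Matrix.det hPQ
    rw [det_mul, h0] at this
    simp at this
  exact mul_left_cancel₀ (pow_ne_zero d hdet) h

theorem degClosed_of_inv {K : Type*} [Field K] [CharZero K] {f : PR K} {d : ℕ} (hf : f ∈ pureAlg K 4) (hd : f.IsHomogeneous d)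
    (hpos : 0 < d) {L : Type*} [Field L] [Algebra K L] [CharZero L] :
    DegClosed (fun A B : Mat4 L => aeval (pairSub A B) f = 0) where
  zero := by
    have := homog_scale hd (0 : L) (pairSub 0 0)
    rw [← pairSub_smul, zero_smul, zero_pow hpos.ne', zero_mul] at this
    exact this
  conj := fun P Q A B hPQ h => by rwa [conj_ext hf hd P Q A B hPQ] at h
  lim := fun p X Y hp hX hY h => by
    let D : Mat4 L → Mat4 L := fun X => p * X * p + (1 - p) * X * (1 - p)
    let N : Mat4 L → Mat4 L := fun X => (1 - p) * X * p
    let G : Mat4 L → Mat4 (Polynomial L) := fun X => (D X).map Polynomial.C + (Polynomial.X : Polynomial L) • (N X).map Polynomial.C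
    have hG : ∀ t X, ((Polynomial.aeval t).restrictScalars K : Polynomial L →ₐ[K] L).mapMatrix (G X) = D X + t • N X := by
      intro t X
      ext i j
      simp [G]
      ring
    have hev : ∀ t, (aeval (pairSub (G X) (G Y)) f).eval t = aeval (pairSub (D X + t • N X) (D Y + t • N Y)) f := by
      intro t
      have := ev_nat ((Polynomial.aeval t).restrictScalars K : Polynomial L →ₐ[K] L) (G X) (G Y) f
      rw [hG, hG] at this
      rw [← this]
      simp [Polynomial.aeval_def]
    have hpn : p * (1 - p) = 0 := by rw [mul_sub, hp]; simp
    have hnp : (1 - p) * p = 0 := by rw [sub_mul, hp]; simp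
    have hnn : (1 - p) * (1 - p) = 1 - p := by rw [sub_mul (1 : Mat4 L), hpn]; simp
    have hc : ∀ t : L, t ≠ 0 → ∀ X : Mat4 L, p * X * (1 - p) = 0 → 
        D X + t • N X = (p + t • (1 - p)) * X * (p + t⁻¹ • (1 - p)) := by
      intro t ht X hX
      simp only [D, N, add_mul, mul_add, Matrix.smul_mul, Matrix.mul_smul, hX, smul_zero, smul_smul, inv_mul_cancel₀ ht, one_smul]
      simp; abel
    have hpq : ∀ t : L, t ≠ 0 → (p + t • (1 - p)) * (p + t⁻¹ • (1 - p)) = 1 := by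
      intro t ht
      simp only [add_mul, mul_add, Matrix.smul_mul, Matrix.mul_smul, hpn, hnp, hnn, hp, smul_zero, smul_smul, inv_mul_cancel₀ ht, one_smul]
      simp
    have hconst : aeval (pairSub (G X) (G Y)) f = Polynomial.C (aeval (pairSub X Y) f) := by
      apply Polynomial.eq_of_infinite_eval_eq
      apply Set.Infinite.mono (s := {0}ᶜ) _ (Set.finite_singleton (0 : L)).infinite_compl
      intro t ht
      have ht' : t ≠ 0 := ht
      change Polynomial.eval _ _ = Polynomial.eval _ _
      rw [hev, Polynomial.eval_C, hc t ht' X hX, hc t ht' Y hY]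
      exact conj_ext hf hd _ _ _ _ (hpq t ht')
    have h0 := hev 0
    rw [hconst, Polynomial.eval_C, zero_smul, zero_smul, add_zero, add_zero] at h0
    rw [h0]; exact h

theorem vanish {K : Type*} [Field K] [CharZero K] {f : PR K} {d : ℕ} (hf : f ∈ pureAlg K 4) (hd : f.IsHomogeneous d)
    (hpos : 0 < d) {L : Type*} [Field L] [Algebra K L] [CharZero L] (A B : Mat4 L) (h : ∀ i, trs A B i = 0) :
    aeval (pairSub A B) f = 0 := by
  apply nullcone (degClosed_of_inv hf hd hpos)
  exact
  { hx := ch4 _ (h 0) (h 2) (h 5) (h 9)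
    hy := ch4 _ (h 1) (h 4) (h 8) (h 13)
    tx := h 0
    ty := h 1
    t11 := h 3
    t21 := h 6
    t12 := h 7
    t31 := h 10
    t22 := h 11
    t13 := h 12
    t1111 := h 14
    t42 := h 15
    t24 := h 16 }

theorem inv_mem_radical {K : Type*} [Field K] [CharZero K] {f : PR K} {d : ℕ} (hf : f ∈ pureAlg K 4) (hd : f.IsHomogeneous d)
    (hpos : 0 < d) : f ∈ (Ideal.span (Set.range (hsop17 K))).radical := by
  rw [Ideal.radical_eq_sInf, Ideal.mem_sInf]
  rintro P ⟨hIP, hP⟩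
  let L := FractionRing (PR K ⧸ P)
  let φ : PR K →ₐ[K] L := (IsScalarTower.toAlgHom K (PR K ⧸ P) L).comp (Ideal.Quotient.mkₐ K P)
  have hφ : ∀ g, φ g = 0 ↔ g ∈ P := by
    intro g
    change algebraMap (PR K ⧸ P) L (Ideal.Quotient.mk P g) = 0 ↔ _
    rw [← Ideal.Quotient.eq_zero_iff_mem]
    exact (IsFractionRing.injective (PR K ⧸ P) L).eq_iff' (_root_.map_zero _)
  have : CharZero L := charZero_of_injective_algebraMap (algebraMap K L).injective
  rw [← hφ, ← ev_gen f, ev_nat]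
  apply vanish hf hd hpos
  intro i
  rw [← ev_hsop (K := K), ← ev_nat, ev_gen, hφ]
  exact hIP (Ideal.subset_span ⟨i, rfl⟩)

end part7

section part8

section waring
variable {σ K : Type*} [Fintype σ] [Field K] [CharZero K]

noncomputable def lf (l : σ → K) : MvPolynomial σ K := ∑ i, l i • X i

theorem lf_pow [DecidableEq σ] (l : σ → K) (N : ℕ) : lf l ^ N = 
    ∑ k ∈ Finset.piAntidiag Finset.univ N, ((Nat.multinomial Finset.univ k : K) * ∏ i, l i ^ k i) • 
      monomial (Finsupp.equivFunOnFinite.symm k) (1 : K) := by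
  rw [lf, Finset.sum_pow_eq_sum_piAntidiag]
  apply Finset.sum_congr rfl
  intro k _
  simp only [smul_eq_C_mul, mul_pow, Finset.prod_mul_distrib, C_mul, _root_.map_prod, C_pow]
  rw [monomial_eq, Finsupp.prod_fintype _ _ (by simp)]
  simp [mul_assoc]

theorem mul_pos_mult (s : Finset σ) (k : σ → ℕ) : (Nat.multinomial s k : K) ≠ 0 := by
  exact_mod_cast (Nat.multinomial_pos s k).ne'

theorem waring (N : ℕ) (P : MvPolynomial σ K) (hP : P.IsHomogeneous N) :
    P ∈ Submodule.span K (Set.range fun l : σ → K => lf l ^ N) := by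
  classical
  by_contra hn
  obtain ⟨ψ, h1, h2⟩ := Submodule.exists_le_ker_of_notMem hn
  have h3 : ∀ l : σ → K, ψ (lf l ^ N) = 0 := fun l => h2 (Submodule.subset_span ⟨l, rfl⟩)
  let G : MvPolynomial σ K := ∑ k ∈ Finset.piAntidiag Finset.univ N, 
    monomial (Finsupp.equivFunOnFinite.symm k) ((Nat.multinomial Finset.univ k : K) * ψ (monomial (Finsupp.equivFunOnFinite.symm k) (1 : K)))
  have hG : G = 0 := by
    apply MvPolynomial.funext
    intro l
    rw [_root_.map_zero, ← h3 l, lf_pow, _root_.map_sum, _root_.map_sum]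
    apply Finset.sum_congr rfl
    intro k _
    rw [eval_monomial, _root_.map_smul, Finsupp.prod_fintype _ _ (by simp)]
    simp only [Finsupp.equivFunOnFinite_symm_apply_apply, smul_eq_mul]
    ring
  apply h1
  conv_lhs => rw [P.as_sum]
  rw [_root_.map_sum]
  apply Finset.sum_eq_zero
  intro m hm
  have hdeg := hP (mem_support_iff.1 hm)
  rw [Finsupp.weight_apply, Finsupp.sum_fintype _ _ (by simp)] at hdeg
  simp only [Pi.one_apply, smul_eq_mul, mul_one] at hdeg
  have hc := congrArg (coeff m) hG
  rw [coeff_zero, coeff_sum, Finset.sum_eq_single (⇑m)] at hc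
  · have hm' : Finsupp.equivFunOnFinite.symm (⇑m) = m := by ext; simp
    rw [hm', coeff_monomial, if_pos rfl] at hc
    have := (mul_eq_zero.1 hc).resolve_left (mul_pos_mult _ _)
    have e : monomial m (coeff m P) = coeff m P • monomial m (1 : K) := by
      rw [smul_monomial]; simp
    rw [e, _root_.map_smul, this, smul_zero]
  · intro b _ hb
    rw [coeff_monomial, if_neg]
    intro h
    apply hb
    rw [← h]; rfl
  · intro h
    exact absurd (by simp [hdeg]) h

noncomputable def apol (H : MvPolynomial σ K) : MvPolynomial σ K →ₗ[K] K :=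
  ∑ m ∈ H.support, (coeff m H * (m.multinomial : K)⁻¹) • lcoeff K m

theorem apol_lf {N : ℕ} {H : MvPolynomial σ K} (hH : H.IsHomogeneous N) (l : σ → K) :
    apol H (lf l ^ N) = eval l H := by
  rw [eval_eq', apol, LinearMap.sum_apply]
  apply Finset.sum_congr rfl
  intro m hm
  have hdeg := hH (mem_support_iff.1 hm)
  have hdeg' : m.sum (fun _ m => m) = N := by
    rw [Finsupp.weight_apply] at hdeg
    simpa using hdeg
  rw [LinearMap.smul_apply, lcoeff_apply, lf, coeff_linearCombination_X_pow_of_fintype, if_pos hdeg', 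
    Finsupp.prod_fintype _ _ (by simp), smul_eq_mul, mul_assoc, ← mul_assoc _ _ (∏ i, _), inv_mul_cancel₀, one_mul]
  rw [Finsupp.multinomial_eq]
  exact mul_pos_mult _ _

theorem apol_self_ne {D : MvPolynomial σ ℤ} (hD : D ≠ 0) :
    apol (MvPolynomial.map (Int.castRingHom K) D) (MvPolynomial.map (Int.castRingHom K) D) ≠ 0 := by
  have hs : (MvPolynomial.map (Int.castRingHom K) D).support = D.support := by
    apply support_map_of_injective
    exact Int.cast_injective
  rw [apol, hs, LinearMap.sum_apply]
  have : ∑ d ∈ D.support, ((coeff d ((MvPolynomial.map (Int.castRingHom K)) D) * (d.multinomial : K)⁻¹) • lcoeff K d)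
    ((MvPolynomial.map (Int.castRingHom K)) D) = ((∑ d ∈ D.support, ((coeff d D : ℤ) : ℚ)^2 * (d.multinomial : ℚ)⁻¹ : ℚ) : K) := by
    push_cast
    apply Finset.sum_congr rfl
    intro d _
    simp [coeff_map]
    ring
  rw [this]
  norm_cast
  apply ne_of_gt
  apply Finset.sum_pos
  · intro m hm
    have h1 : ((coeff m D : ℤ) : ℚ) ≠ 0 := by exact_mod_cast mem_support_iff.1 hm
    have h2 : (0 : ℚ) < m.multinomial := by
      rw [Finsupp.multinomial_eq]
      exact_mod_cast Nat.multinomial_pos _ _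
    push_cast
    exact mul_pos (lt_of_le_of_ne (sq_nonneg _) (pow_ne_zero 2 h1).symm) (inv_pos.2 h2)
  · rwa [Finset.nonempty_iff_ne_empty, ne_eq, support_eq_empty]
end waring

def mat {L : Type*} (v : Fin 4 × Fin 4 → L) : Mat4 L := Matrix.of fun i j => v (i, j)

def vec4 {L : Type*} (M : Mat4 L) : Fin 4 × Fin 4 → L := fun ij => M ij.1 ij.2

theorem det_homog {τ R : Type*} [CommRing R] {n : ℕ} (M : Matrix (Fin n) (Fin n) (MvPolynomial τ R))
    (hM : ∀ i j, (M i j).IsHomogeneous 1) : M.det.IsHomogeneous n := by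
  rw [Matrix.det_apply]
  apply IsHomogeneous.sum
  intro s _
  have : (∏ i, M (s i) i).IsHomogeneous (∑ i : Fin n, 1) := IsHomogeneous.prod _ _ _ fun i _ => hM _ _
  simp only [Finset.sum_const, Finset.card_univ, Fintype.card_fin, smul_eq_mul, mul_one] at this
  rcases Int.units_eq_one_or (Equiv.Perm.sign s) with h | h
  · rw [h, one_smul]; exact this
  · rw [h, Units.neg_smul, one_smul]; exact this.neg

theorem detX_map {K : Type*} [Field K] : 
    MvPolynomial.map (Int.castRingHom K) ((mvPolynomialX (Fin 4) (Fin 4) ℤ).det) = (mvPolynomialX (Fin 4) (Fin 4) K).det := by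
  rw [RingHom.map_det]
  have : (MvPolynomial.map (Int.castRingHom K)).mapMatrix (mvPolynomialX (Fin 4) (Fin 4) ℤ) = mvPolynomialX (Fin 4) (Fin 4) K := by
    ext1 i j
    simp
  rw [this]

theorem design {K : Type*} [Field K] [CharZero K] (e : ℕ) :
    ∃ (s : Finset (Fin 4 × Fin 4 → K)) (c : (Fin 4 × Fin 4 → K) → K), 
    (∑ v ∈ s, c v * (mat v).det ^ e = 1) ∧
    ∀ H : MvPolynomial (Fin 4 × Fin 4) K, H.IsHomogeneous (4 * e) → ∀ g : Mat4 K, 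
      ∑ v ∈ s, c v * eval (vec4 (mat v * g)) H = g.det ^ e * ∑ v ∈ s, c v * eval v H := by
  let D : MvPolynomial (Fin 4 × Fin 4) K := (mvPolynomialX (Fin 4) (Fin 4) K).det
  have hD1 : D.IsHomogeneous 4 := det_homog _ fun i j => isHomogeneous_X _ _
  have hDe : (D ^ e).IsHomogeneous (4 * e) := hD1.pow e
  have hDev : ∀ v, eval v D = (mat v).det := by
    intro v
    simp only [D]
    rw [RingHom.map_det]
    congr 1
    ext i j; simp [mat]
  obtain ⟨c, hc⟩ := Finsupp.mem_span_range_iff_exists_finsupp.1 (waring (4 * e) (D ^ e) hDe)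
  rw [Finsupp.sum] at hc
  have hE : ∀ H : MvPolynomial (Fin 4 × Fin 4) K, H.IsHomogeneous (4 * e) →
      ∑ v ∈ c.support, c v * eval v H = apol H (D ^ e) := by
    intro H hH
    rw [← hc, _root_.map_sum]
    apply Finset.sum_congr rfl
    intro v _
    rw [_root_.map_smul, apol_lf hH, smul_eq_mul]
  have hE2 : ∀ H : MvPolynomial (Fin 4 × Fin 4) K, H.IsHomogeneous (4 * e) → ∀ g : Mat4 K, 
      ∑ v ∈ c.support, c v * eval (vec4 (mat v * g)) H = g.det ^ e * ∑ v ∈ c.support, c v * eval v H := by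
    intro H hH g
    let θ : MvPolynomial (Fin 4 × Fin 4) K →ₐ[K] MvPolynomial (Fin 4 × Fin 4) K :=
      aeval fun ik => ∑ j, g ik.2 j • X (ik.1, j)
    have hθ1 : ∀ v, θ (lf v) = lf (vec4 (mat v * g)) := by
      intro v
      simp only [lf, θ, _root_.map_sum, _root_.map_smul, aeval_X, vec4, Matrix.mul_apply, Fintype.sum_prod_type, Finset.smul_sum,
        Finset.sum_smul, smul_smul, mat, Matrix.of_apply]
      apply Finset.sum_congr rfl
      intro i _
      rw [Finset.sum_comm]
    have hθ2 : θ D = C g.det * D := by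
      simp only [D]
      rw [AlgHom.map_det]
      have : θ.mapMatrix (mvPolynomialX (Fin 4) (Fin 4) K) = mvPolynomialX (Fin 4) (Fin 4) K * (C.mapMatrix g)ᵀ := by
        ext1 i j
        simp [θ, Matrix.mul_apply, smul_eq_C_mul, mul_comm]
      rw [this, det_mul, det_transpose, ← RingHom.map_det, mul_comm]
    have h1 := congrArg θ hc
    rw [_root_.map_sum, _root_.map_pow, hθ2, mul_pow, ← C_pow] at h1
    have h2 := congrArg (apol H) h1
    rw [_root_.map_sum, ← smul_eq_C_mul, _root_.map_smul, ← hE H hH, smul_eq_mul] at h2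
    rw [← h2]
    apply Finset.sum_congr rfl
    intro v _
    rw [_root_.map_smul, _root_.map_smul, _root_.map_pow, hθ1, apol_lf hH, smul_eq_mul]
  have hne : ∑ v ∈ c.support, c v * (mat v).det ^ e ≠ 0 := by
    have : ∑ v ∈ c.support, c v * (mat v).det ^ e = apol (D ^ e) (D ^ e) := by
      rw [← hE _ hDe]
      simp only [_root_.map_pow, hDev]
    rw [this]
    have hmap : D ^ e = MvPolynomial.map (Int.castRingHom K) ((mvPolynomialX (Fin 4) (Fin 4) ℤ).det ^ e) := by
      rw [_root_.map_pow, detX_map]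
    rw [hmap]
    apply apol_self_ne
    apply pow_ne_zero
    exact det_mvPolynomialX_ne_zero _ _
  refine ⟨c.support, fun v => (∑ v ∈ c.support, c v * (mat v).det ^ e)⁻¹ * c v, ?_, ?_⟩
  · simp only [mul_assoc]
    rw [← Finset.mul_sum, inv_mul_cancel₀ hne]
  · intro H hH g
    simp only [mul_assoc]
    rw [← Finset.mul_sum, ← Finset.mul_sum, hE2 H hH g]
    ring

end part8

section part9

theorem homComp_mul {σ K : Type*} [Field K] {a : MvPolynomial σ K} {d : ℕ} (ha : a.IsHomogeneous d) (r : MvPolynomial σ K) (e : ℕ) :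
    homogeneousComponent e (a * r) = if d ≤ e then a * homogeneousComponent (e - d) r else 0 := by
  classical
  letI : GradedAlgebra (homogeneousSubmodule σ K) := gradedAlgebra
  have h := DirectSum.coe_decompose_mul_of_left_mem (𝒜 := homogeneousSubmodule σ K) (a := a) (b := r) e ((mem_homogeneousSubmodule _ _).2 ha)
  have h2 := fun φ i => decomposition.decompose'_apply (R := K) (σ := σ) φ i
  have h3 : ∀ φ i, ((DirectSum.decompose (homogeneousSubmodule σ K) φ i : _) : MvPolynomial σ K) = homogeneousComponent i φ := h2
  rw [h3, h3] at h
  exact h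

theorem homComp_self {σ K : Type*} [Field K] {a : MvPolynomial σ K} {d : ℕ} (ha : a.IsHomogeneous d) :
    homogeneousComponent d a = a := by
  rw [homogeneousComponent_of_mem ((mem_homogeneousSubmodule _ _).2 ha), if_pos rfl]

/-- substitution by `l` -/
noncomputable def sstar {K : Type*} [Field K] (l : Mat4 K) (r : PR K) : PR K :=
  aeval (pairSub (C.mapMatrix l * genX K 4 * (C.mapMatrix l).adjugate) (C.mapMatrix l * genY K 4 * (C.mapMatrix l).adjugate)) r

theorem sstar_homog {K : Type*} [Field K] (l : Mat4 K) {r : PR K} {d : ℕ} (hr : r.IsHomogeneous d) : (sstar l r).IsHomogeneous d := by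
  have hC : ∀ m : Mat4 K, MH (C.mapMatrix m : Mat4 (PR K)) 0 := fun m i j => isHomogeneous_C _ _
  have hx : MH (genX K 4) 1 := fun i j => isHomogeneous_X _ _
  have hy : MH (genY K 4) 1 := fun i j => isHomogeneous_X _ _
  rw [sstar, ← RingHom.map_adjugate]
  have h := hr.aeval (S := K) (pairSub (C.mapMatrix l * genX K 4 * C.mapMatrix l.adjugate) (C.mapMatrix l * genY K 4 * C.mapMatrix l.adjugate)) (n := 1) ?_
  · rwa [one_mul] at h
  · rintro (i | i)
    · exact (((hC l).mul hx).mul (hC l.adjugate)) i.1 i.2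
    · exact (((hC l).mul hy).mul (hC l.adjugate)) i.1 i.2

theorem sstar_eval {K : Type*} [Field K] (l : Mat4 K) (r : PR K) (A B : Mat4 K) :
    aeval (pairSub A B) (sstar l r) = aeval (pairSub (l * A * l.adjugate) (l * B * l.adjugate)) r := by
  have hC : ∀ m : Mat4 K, (aeval (pairSub A B) : PR K →ₐ[K] K).mapMatrix (C.mapMatrix m : Mat4 (PR K)) = m := by
    intro m; ext i j; simp
  rw [sstar, ev_nat, ← RingHom.map_adjugate]
  simp only [_root_.map_mul, hC, ev_genX, ev_genY]

theorem sstar_inv {K : Type*} [Field K] [CharZero K] (l : Mat4 K) {f : PR K} {d : ℕ} (hf : f ∈ pureAlg K 4) (hd : f.IsHomogeneous d) :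
    sstar l f = C (l.det ^ d) * f := by
  rw [sstar, adj_conj hf hd, ev_gen, ← RingHom.map_det, C_pow]

theorem adj_homog {K : Type*} [Field K] (i j : Fin 4) : 
    ((mvPolynomialX (Fin 4) (Fin 4) K).adjugate i j).IsHomogeneous 3 := by
  rw [adjugate_fin_succ_eq_det_submatrix]
  have h : ((mvPolynomialX (Fin 4) (Fin 4) K).submatrix j.succAbove i.succAbove).det.IsHomogeneous 3 :=
    det_homog _ fun i j => isHomogeneous_X _ _
  rcases neg_one_pow_eq_or (MvPolynomial (Fin 4 × Fin 4) K) (j + i : ℕ) with h1 | h1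
  · rw [h1, one_mul]; exact h
  · rw [h1, neg_one_mul]; exact h.neg

theorem rey_inv {K : Type*} [Field K] [CharZero K] (d e' : ℕ) {r : PR K} (hr : r.IsHomogeneous e')
    (s : Finset (Fin 4 × Fin 4 → K)) (c : (Fin 4 × Fin 4 → K) → K)
    (hs : ∀ H : MvPolynomial (Fin 4 × Fin 4) K, H.IsHomogeneous (4 * (d + e')) → ∀ g : Mat4 K, 
      ∑ v ∈ s, c v * eval (vec4 (mat v * g)) H = g.det ^ (d + e') * ∑ v ∈ s, c v * eval v H) :
    ∑ v ∈ s, C (c v * (mat v).det ^ d) * sstar (mat v) r ∈ pureAlg K 4 := by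
  intro a A B
  have hdet : (a : Mat4 K).det ≠ 0 := by
    have := (Matrix.isUnit_iff_isUnit_det _).1 a.isUnit
    exact this.ne_zero
  let Z := mvPolynomialX (Fin 4) (Fin 4) K
  let H : MvPolynomial (Fin 4 × Fin 4) K := 
    Z.det ^ d * aeval (pairSub (Z * C.mapMatrix A * Z.adjugate) (Z * C.mapMatrix B * Z.adjugate)) r
  have hH : H.IsHomogeneous (4 * (d + e')) := by
    rw [mul_add]
    apply IsHomogeneous.mul
    · exact (det_homog Z fun i j => isHomogeneous_X _ _).pow d
    · have key : ∀ (M : Mat4 K) i j, ((Z * C.mapMatrix M * Z.adjugate : Mat4 (MvPolynomial (Fin 4 × Fin 4) K)) i j).IsHomogeneous 4 := by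
        intro M i j
        rw [Matrix.mul_apply]
        apply IsHomogeneous.sum
        intro k _
        apply IsHomogeneous.mul (m := 1) (n := 3) _ (adj_homog _ _)
        rw [Matrix.mul_apply]
        apply IsHomogeneous.sum
        intro k' _
        exact IsHomogeneous.mul (m := 1) (n := 0) (isHomogeneous_X _ _) (isHomogeneous_C _ _)
      apply hr.aeval
      rintro (i | i)
      · exact key A _ _
      · exact key B _ _
  have hHev : ∀ M : Mat4 K, eval (vec4 M) H = M.det ^ d * aeval (pairSub (M * A * M.adjugate) (M * B * M.adjugate)) r := by
    intro M
    rw [← aeval_eq_eval]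
    set φ := aeval (R := K) (vec4 M)
    change φ _ = _
    have hZ : φ.mapMatrix Z = M := by ext i j; simp [φ, Z, vec4]
    have hC : ∀ m : Mat4 K, φ.mapMatrix (C.mapMatrix m) = m := by intro m; ext i j; simp [φ]
    simp only [H, _root_.map_mul, _root_.map_pow, ev_nat, AlgHom.map_det]
    rw [AlgHom.map_adjugate, hZ, hC, hC]
  have hev : ∀ A B : Mat4 K, eval (pairSub A B) (∑ v ∈ s, C (c v * (mat v).det ^ d) * sstar (mat v) r) = 
      ∑ v ∈ s, c v * ((mat v).det ^ d * aeval (pairSub (mat v * A * (mat v).adjugate) (mat v * B * (mat v).adjugate)) r) := by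
    intro A B
    rw [_root_.map_sum]
    apply Finset.sum_congr rfl
    intro v _
    rw [_root_.map_mul, eval_C, ← sstar_eval, mul_assoc]
    rfl
  rw [hev, hev]
  have h1 := hs H hH a
  have hv : ∀ v : Fin 4 × Fin 4 → K, vec4 (mat v) = v := fun v => by funext i; simp [vec4, mat]
  have h2 : ∑ v ∈ s, c v * eval v H = ∑ v ∈ s, c v * ((mat v).det ^ d * aeval (pairSub (mat v * A * (mat v).adjugate) (mat v * B * (mat v).adjugate)) r) := by
    apply Finset.sum_congr rfl
    intro v _
    rw [← hHev, hv]
  rw [← h2]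
  apply mul_left_cancel₀ (pow_ne_zero (d + e') hdet)
  rw [← h1, Finset.mul_sum]
  apply Finset.sum_congr rfl
  intro v _
  rw [hHev, adjugate_mul_distrib]
  have hai : (a : Mat4 K).adjugate = (a : Mat4 K).det • ((a⁻¹ : GL (Fin 4) K) : Mat4 K) := by
    have : (a : Mat4 K) * ((a⁻¹ : GL (Fin 4) K) : Mat4 K) = 1 := by simp
    calc (a : Mat4 K).adjugate = (a : Mat4 K).adjugate * ((a : Mat4 K) * ((a⁻¹ : GL (Fin 4) K) : Mat4 K)) := by rw [this, mul_one]
        _ = _ := by rw [← mul_assoc, adjugate_mul]; simp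
  rw [hai]
  have e1 : ∀ A : Mat4 K, mat v * ↑a * A * ((a : Mat4 K).det • ((a⁻¹ : GL (Fin 4) K) : Mat4 K) * (mat v).adjugate)
      = (a : Mat4 K).det • (mat v * (↑a * A * ((a⁻¹ : GL (Fin 4) K) : Mat4 K)) * (mat v).adjugate) := by
    intro A
    simp only [Matrix.smul_mul, Matrix.mul_smul, mul_assoc]
  rw [e1, e1, pairSub_smul, homog_scale hr, det_mul, mul_pow, pow_add]
  ring

theorem rey {K : Type*} [Field K] [CharZero K] {ι : Type*} [Fintype ι] (a : ι → PR K) (da : ι → ℕ)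
    (ha : ∀ i, a i ∈ pureAlg K 4) (hda : ∀ i, (a i).IsHomogeneous (da i)) {f : PR K} {e : ℕ}
    (hf : f ∈ pureAlg K 4) (he : f.IsHomogeneous e) (hmem : f ∈ Ideal.span (Set.range a)) :
    ∃ c : ι → PR K, f = ∑ i, c i * a i ∧ ∀ i, c i ∈ pureAlg K 4 ∧ (c i).IsHomogeneous (e - da i) ∧ (e < da i → c i = 0) := by
  classical
  obtain ⟨r0, hr0⟩ := Ideal.mem_span_range_iff_exists_fun.1 hmem
  let r : ι → PR K := fun i => if da i ≤ e then homogeneousComponent (e - da i) (r0 i) else 0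
  have hr : ∀ i, (r i).IsHomogeneous (e - da i) := by
    intro i
    simp only [r]
    split_ifs
    · exact homogeneousComponent_isHomogeneous _ _
    · exact isHomogeneous_zero _ _ _
  have hfr : f = ∑ i, r i * a i := by
    rw [← homComp_self he, ← hr0, _root_.map_sum]
    apply Finset.sum_congr rfl
    intro i _
    rw [mul_comm, homComp_mul (hda i)]
    simp only [r]
    split_ifs
    · rw [mul_comm]
    · rw [zero_mul]
  obtain ⟨s, c, hc1, hc2⟩ := design (K := K) e
  refine ⟨fun i => ∑ v ∈ s, C (c v * (mat v).det ^ (da i)) * sstar (mat v) (r i), ?_, ?_⟩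
  · have h1 : ∀ v, C (c v * (mat v).det ^ e) * f = ∑ i, C (c v * (mat v).det ^ (da i)) * sstar (mat v) (r i) * a i := by
      intro v
      have h2 : sstar (mat v) f = ∑ i, sstar (mat v) (r i) * sstar (mat v) (a i) := by
        conv_lhs => rw [hfr]
        simp only [sstar, _root_.map_sum, _root_.map_mul]
      rw [sstar_inv _ hf he] at h2
      rw [C_mul, mul_assoc, h2, Finset.mul_sum]
      apply Finset.sum_congr rfl
      intro i _
      rw [sstar_inv _ (ha i) (hda i), C_mul]
      ring
    calc f = C (∑ v ∈ s, c v * (mat v).det ^ e) * f := by rw [hc1, C_1, one_mul]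
      _ = ∑ v ∈ s, C (c v * (mat v).det ^ e) * f := by rw [_root_.map_sum, Finset.sum_mul]
      _ = _ := by
        simp only [h1, Finset.sum_mul]
        rw [Finset.sum_comm]
  · intro i
    have hz : ¬ da i ≤ e → r i = 0 := fun h => by simp [r, h]
    by_cases hle : da i ≤ e
    · refine ⟨?_, ?_, fun h => absurd hle (by omega)⟩
      · apply rey_inv (da i) (e - da i) (hr i)
        rw [Nat.add_sub_cancel' hle]
        exact hc2
      · apply IsHomogeneous.sum
        intro v _
        have := (isHomogeneous_C (MatVar 4) (c v * (mat v).det ^ (da i))).mul (sstar_homog (mat v) (hr i))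
        rwa [zero_add] at this
    · have h0 : ∑ v ∈ s, C (c v * (mat v).det ^ (da i)) * sstar (mat v) (r i) = 0 := by
        apply Finset.sum_eq_zero
        intro v _
        rw [hz hle, sstar, _root_.map_zero, mul_zero]
      beta_reduce
      rw [h0]
      exact ⟨Subalgebra.zero_mem _, isHomogeneous_zero _ _ _, fun _ => rfl⟩

end part9

section part10

theorem exists_threshold (K : Type*) [Field K] [CharZero K] : ∃ D : ℕ, ∀ (f : PR K) (e : ℕ), f ∈ pureAlg K 4 →
    f.IsHomogeneous e → D < e → f ∈ Ideal.span (Set.range (hsop17 K)) := by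
  classical
  let G : Set (PR K) := {f | f ∈ pureAlg K 4 ∧ ∃ d, 0 < d ∧ f.IsHomogeneous d}
  let J : Ideal (PR K) := Ideal.span G
  have hfg : J.FG := IsNoetherian.noetherian J
  obtain ⟨T, hTG, hTJ⟩ := Submodule.fg_span_iff_fg_span_finset_subset G |>.1 hfg
  have hrad : J ≤ (Ideal.span (Set.range (hsop17 K))).radical := by
    apply Ideal.span_le.2
    rintro f ⟨hf, d, hd, hh⟩
    exact inv_mem_radical hf hh hd
  obtain ⟨m, hm⟩ := Ideal.exists_pow_le_of_le_radical_of_fg hrad hfg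
  choose! dd hdd using fun (f : PR K) (hf : f ∈ T) => (hTG hf).2
  let δ := T.sup dd
  have key : ∀ (m : ℕ) (e : ℕ) (f : PR K), f ∈ pureAlg K 4 → f.IsHomogeneous e → m * δ < e → f ∈ J ^ m := by
    intro m
    induction m with
    | zero => intro e f _ _ _; simp
    | succ m ih =>
      intro e f hf he hlt
      have hfJ : f ∈ Ideal.span (Set.range (fun t : T => (t : PR K))) := by
        have h1 : f ∈ J := Ideal.subset_span ⟨hf, e, by omega, he⟩
        have h2 : Set.range (fun t : T => (t : PR K)) = (T : Set (PR K)) := Subtype.range_coe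
        rw [h2]
        change f ∈ Submodule.span (PR K) G at h1
        rw [hTJ] at h1
        exact h1
      obtain ⟨c, hc, hc2⟩ := rey (fun t : T => (t : PR K)) (fun t => dd t) (fun t => (hTG t.2).1) (fun t => (hdd t t.2).2) hf he hfJ
      rw [hc, pow_succ]
      apply Ideal.sum_mem
      intro t _
      apply Ideal.mul_mem_mul
      · obtain ⟨a1, a2, a3⟩ := hc2 t
        apply ih _ _ a1 a2
        have : dd t ≤ δ := Finset.le_sup t.2
        rw [Nat.succ_mul] at hlt
        omega
      · exact Ideal.subset_span (hTG t.2)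
  exact ⟨m * δ, fun f e hf he hlt => hm (key m e f hf he hlt)⟩

theorem hsop_fin (K : Type*) [Field K] [CharZero K] : 
    (∃ (m : ℕ) (Q : Fin m → MvPolynomial (MatVar 4) K),
      (∀ j, Q j ∈ pureAlg K 4) ∧
      ∀ f ∈ pureAlg K 4, ∃ c : Fin m → MvPolynomial (MatVar 4) K,
        (∀ j, c j ∈ Algebra.adjoin K (Set.range (hsop17 K))) ∧ f = ∑ j, c j * Q j) := by
  classical
  obtain ⟨D, hD⟩ := exists_threshold K
  let A := Algebra.adjoin K (Set.range (hsop17 K))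
  let W : Submodule K (PR K) := restrictTotalDegree (MatVar 4) K D ⊓ (pureAlg K 4).toSubmodule
  have hW : W.FG := by
    have : IsNoetherian K (restrictTotalDegree (MatVar 4) K D) := inferInstance
    exact Submodule.FG.of_le (Module.Finite.iff_fg.1 inferInstance) inf_le_left
  obtain ⟨m, Q, hQ⟩ := Submodule.fg_iff_exists_fin_generating_family.1 hW
  have hQW : ∀ j, Q j ∈ W := fun j => hQ ▸ Submodule.subset_span ⟨j, rfl⟩
  refine ⟨m, Q, fun j => (hQW j).2, ?_⟩
  let N : Submodule A (PR K) := Submodule.span A (Set.range Q)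
  have hWN : ∀ f ∈ W, f ∈ N := by
    intro f hf
    rw [← hQ] at hf
    exact Submodule.span_le_restrictScalars K A _ hf
  have key : ∀ (e : ℕ) (f : PR K), f ∈ pureAlg K 4 → f.IsHomogeneous e → f ∈ N := by
    intro e
    induction e using Nat.strong_induction_on with
    | _ e ih =>
      intro f hf he
      by_cases hlt : D < e
      · obtain ⟨c, hc, hc2⟩ := rey (hsop17 K) hdeg hsop_inv hsop_homog hf he (hD f e hf he hlt)
        rw [hc]
        apply Submodule.sum_mem
        intro i _
        obtain ⟨a1, a2, a3⟩ := hc2 i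
        have hci : c i ∈ N := ih _ (by have := hdeg_pos i; omega) _ a1 a2
        have := N.smul_mem (⟨hsop17 K i, Algebra.subset_adjoin ⟨i, rfl⟩⟩ : A) hci
        rw [mul_comm]
        exact this
      · apply hWN
        refine ⟨?_, hf⟩
        rw [SetLike.mem_coe, mem_restrictTotalDegree]
        exact he.totalDegree_le.trans (not_lt.1 hlt)
  intro f hf
  have hfN : f ∈ N := by
    rw [← sum_homogeneousComponent f]
    apply Submodule.sum_mem
    intro d _
    exact key d _ (inv_comp hf d) (homogeneousComponent_isHomogeneous _ _)
  obtain ⟨c, hc⟩ := (Submodule.mem_span_range_iff_exists_fun A).1 hfN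
  exact ⟨fun j => c j, fun j => (c j).2, hc.symm⟩

end part10

section part11

theorem pd_coeff {σ K : Type*} [Field K] (i : σ) (f : MvPolynomial σ K) (m : σ →₀ ℕ) :
    coeff m (pderiv i f) = coeff (m + Finsupp.single i 1) f * (m i + 1) := by
  classical
  induction f using MvPolynomial.induction_on' with
  | monomial s a =>
    rw [pderiv_monomial, coeff_monomial, coeff_monomial]
    by_cases h : s = m + Finsupp.single i 1
    · subst h
      simp
    · rw [if_neg h, zero_mul]
      by_cases h2 : s i = 0
      · simp [h2]
      · rw [if_neg]
        intro h3
        apply h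
        rw [← h3]
        ext j
        by_cases hj : i = j
        · subst hj; simp; omega
        · simp [hj]
  | add p q hp hq => rw [_root_.map_add, coeff_add, hp, hq, coeff_add]; ring

theorem pd_chain {σ τ K : Type*} [Field K] [Fintype σ] (h : σ → MvPolynomial τ K) (v : τ) (P : MvPolynomial σ K) :
    pderiv v (aeval h P) = ∑ i, aeval h (pderiv i P) * pderiv v (h i) := by
  classical
  induction P using MvPolynomial.induction_on with
  | C a => simp [algebraMap_eq]
  | add p q hp hq => simp only [_root_.map_add, hp, hq, add_mul, Finset.sum_add_distrib]
  | mul_X p n hp =>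
    simp only [_root_.map_mul, Derivation.leibniz, aeval_X, hp, smul_eq_mul, _root_.map_add, pderiv_X, add_mul, Finset.sum_add_distrib]
    congr 1
    · rw [Finset.sum_eq_single n]
      · simp
      · intro b _ hb; simp [Pi.single_apply, hb.symm]
      · simp
    · rw [Finset.mul_sum]
      apply Finset.sum_congr rfl
      intro i _
      ring

theorem jac_crit {σ τ K : Type*} [Field K] [CharZero K] [Fintype σ] [DecidableEq σ] (h : σ → MvPolynomial τ K) (v : σ → τ)
    (hdet : (Matrix.of fun i k => pderiv (v k) (h i)).det ≠ 0) : AlgebraicIndependent K h := by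
  rw [algebraicIndependent_iff]
  have key : ∀ (n : ℕ) (P : MvPolynomial σ K), (∀ m ∈ P.support, m.degree ≤ n) → aeval h P = 0 → P = 0 := by
    intro n
    induction n with
    | zero =>
      intro P hP h0
      have hC : P = C (coeff 0 P) := by
        ext m
        rw [coeff_C]
        split_ifs with hm
        · rw [hm]
        · by_contra hne
          have := hP m (mem_support_iff.2 hne)
          exact hm ((Finsupp.degree_eq_zero_iff m).1 (by omega)).symm
      rw [hC, aeval_C, algebraMap_eq, C_eq_zero] at h0
      rw [hC, h0, C_0]
    | succ n ih =>
      intro P hP h0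
      have hpd : ∀ i, pderiv i P = 0 := by
        have hu : (fun i => aeval h (pderiv i P)) = 0 := by
          apply Matrix.eq_zero_of_vecMul_eq_zero hdet
          funext k
          have := pd_chain h (v k) P
          rw [h0, _root_.map_zero] at this
          rw [Matrix.vecMul, dotProduct, Pi.zero_apply, this]
          rfl
        intro i
        apply ih
        · intro m hm
          rw [mem_support_iff, pd_coeff] at hm
          have := hP _ (mem_support_iff.2 (left_ne_zero_of_mul hm))
          rw [_root_.map_add, Finsupp.degree_single] at this
          omega
        · exact congrFun hu i
      apply ih P _ h0
      intro m hm
      by_cases hm0 : m = 0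
      · subst hm0; simp
      exfalso
      obtain ⟨i, hi⟩ := Finsupp.ne_iff.1 hm0
      have h1 := pd_coeff i P (m - Finsupp.single i 1)
      rw [hpd i, coeff_zero] at h1
      have h2 : m - Finsupp.single i 1 + Finsupp.single i 1 = m := by
        ext j
        by_cases hj : i = j
        · subst hj; simp at hi ⊢; omega
        · simp [hj]
      rw [h2] at h1
      rcases mul_eq_zero.1 h1.symm with h3 | h3
      · exact mem_support_iff.1 hm h3
      · exact Nat.cast_add_one_ne_zero _ h3
  intro P h0
  exact key (P.support.sup Finsupp.degree) P (fun m hm => Finset.le_sup (f := Finsupp.degree) hm) h0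

/-- letters -/
def lett {S : Type*} (x y : Mat4 S) (b : Bool) : Mat4 S := if b then y else x

def wev {S : Type*} [CommRing S] (x y : Mat4 S) : List Bool → Mat4 S
  | [] => 1
  | c :: w => lett x y c * wev x y w

/-- noncommutative gradient (cyclic derivative) of the trace of a word -/
def wgrad {S : Type*} [CommRing S] (x y : Mat4 S) (p : Mat4 S) : List Bool → Bool → Mat4 S
  | [], _ => 0
  | c :: w, b => (if b = c then wev x y w * p else 0) + wgrad x y (p * lett x y c) w b

def wds : Fin 17 → List Bool := ![[false], [true], [false, false], [false, true], [true, true],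
  [false, false, false], [false, false, true], [false, true, true], [true, true, true],
  [false, false, false, false], [false, false, false, true], [false, false, true, true], [false, true, true, true],
  [true, true, true, true], [false, true, false, true],
  [false, false, true, false, false, true], [true, true, false, true, true, false]]

theorem hsop_wds {K : Type*} [Field K] (i : Fin 17) : hsop17 K i = (wev (genX K 4) (genY K 4) (wds i)).trace := by
  fin_cases i <;> simp [hsop17, wds, wev, lett, pow_succ, mul_assoc]

theorem wev_map {S T : Type*} [CommRing S] [CommRing T] (f : S →+* T) (x y : Mat4 S) (w : List Bool) :
    f.mapMatrix (wev x y w) = wev (f.mapMatrix x) (f.mapMatrix y) w := by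
  induction w with
  | nil => simp only [wev, _root_.map_one]
  | cons c w ih => cases c <;> simp only [wev, _root_.map_mul, ih, lett] <;> rfl

theorem wgrad_map {S T : Type*} [CommRing S] [CommRing T] (f : S →+* T) (x y p : Mat4 S) (w : List Bool) (b : Bool) :
    f.mapMatrix (wgrad x y p w b) = wgrad (f.mapMatrix x) (f.mapMatrix y) (f.mapMatrix p) w b := by
  induction w generalizing p with
  | nil => simp only [wgrad, _root_.map_zero]
  | cons c w ih => 
    have hl : f.mapMatrix (lett x y c) = lett (f.mapMatrix x) (f.mapMatrix y) c := by cases c <;> rfl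
    simp only [wgrad, _root_.map_add, ih, _root_.map_mul, hl]
    split_ifs <;> simp only [_root_.map_mul, wev_map, _root_.map_zero]

theorem D_mul {K R : Type*} [CommRing K] [CommRing R] [Algebra K R] (D : Derivation K R R) (M N : Mat4 R) :
    (M * N).map D = M.map D * N + M * N.map D := by
  ext i j
  simp only [Matrix.map_apply, Matrix.mul_apply, Matrix.add_apply, _root_.map_sum, Derivation.leibniz, smul_eq_mul,
    Finset.sum_add_distrib]
  rw [add_comm]
  congr 1
  exact Finset.sum_congr rfl fun k _ => mul_comm _ _

theorem D_word {K R : Type*} [CommRing K] [CommRing R] [Algebra K R] (D : Derivation K R R) (x y p : Mat4 R) (w : List Bool) :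
    (p * (wev x y w).map D).trace = (wgrad x y p w false * x.map D).trace + (wgrad x y p w true * y.map D).trace := by
  induction w generalizing p with
  | nil =>
    have : (1 : Mat4 R).map D = 0 := by
      ext i j
      rw [Matrix.map_apply, Matrix.one_apply]
      split_ifs <;> simp
    simp [wev, wgrad, this]
  | cons c w ih =>
    rw [wev, D_mul, mul_add, trace_add, ← mul_assoc p, ← mul_assoc p, ih]
    rw [trace_mul_comm (p * _) _, ← mul_assoc]
    cases c <;> simp [wgrad, lett, add_mul] <;> ring

def wvar (b : Bool) (i j : Fin 4) : MatVar 4 := if b then Sum.inr (i, j) else Sum.inl (i, j)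

theorem pd_hsop {K : Type*} [Field K] (i : Fin 17) (b : Bool) (k l : Fin 4) :
    pderiv (wvar b k l) (hsop17 K i) = wgrad (genX K 4) (genY K 4) 1 (wds i) b l k := by
  have h1 : ∀ (D : Derivation K (PR K) (PR K)) (M : Mat4 (PR K)), D M.trace = (M.map D).trace := by
    intro D M; simp [Matrix.trace]
  rw [hsop_wds, h1]
  have h2 := D_word (pderiv (R := K) (wvar b k l)) (genX K 4) (genY K 4) 1 (wds i)
  rw [one_mul] at h2
  rw [h2]
  have h3 : ∀ M : Mat4 (PR K), (M * Matrix.single k l 1).trace = M l k := by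
    intro M
    rw [Matrix.trace_mul_single]; simp
  cases b
  · have e1 : (genX K 4).map (pderiv (R := K) (wvar false k l)) = Matrix.single k l 1 := by
      ext i j
      simp [genX, wvar, pderiv_X, Pi.single_apply, Matrix.single_apply, eq_comm]
    have e2 : (genY K 4).map (pderiv (R := K) (wvar false k l)) = 0 := by
      ext i j
      simp [genY, wvar, pderiv_X, Pi.single_apply]
    rw [e1, e2, h3, mul_zero, trace_zero, add_zero]
  · have e1 : (genY K 4).map (pderiv (R := K) (wvar true k l)) = Matrix.single k l 1 := by
      ext i j
      simp [genY, wvar, pderiv_X, Pi.single_apply, Matrix.single_apply, eq_comm]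
    have e2 : (genX K 4).map (pderiv (R := K) (wvar true k l)) = 0 := by
      ext i j
      simp [genX, wvar, pderiv_X, Pi.single_apply]
    rw [e1, e2, h3, mul_zero, trace_zero, zero_add]

end part11

section part12

def px {S : Type*} [CommRing S] : Mat4 S := !![0,0,0,0;0,5,0,0;0,0,1,0;0,0,0,4]
def py {S : Type*} [CommRing S] : Mat4 S := !![0,1,1,0;0,0,0,1;0,0,0,1;1,0,0,0]
def pvar : Fin 17 → Bool × Fin 4 × Fin 4 := ![(false, 0, 0), (false, 0, 1), (false, 0, 2), (false, 0, 3), (false, 1, 0), (false, 1, 1), (false, 1, 2), (false, 1, 3), (false, 2, 0), (false, 2, 2), (false, 2, 3), (false, 3, 1), (false, 3, 3), (true, 0, 0), (true, 0, 1), (true, 0, 3), (true, 1, 1)]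
def jinv : Matrix (Fin 17) (Fin 17) (ZMod 7) := !![1, 0, 4, 0, 0, 6, 0, 0, 0, 2, 0, 0, 0, 0, 0, 0, 0;
    0, 0, 0, 0, 0, 0, 0, 0, 0, 0, 0, 0, 0, 0, 5, 4, 0;
    0, 0, 0, 0, 0, 0, 0, 0, 0, 0, 0, 0, 0, 0, 3, 3, 0;
    0, 4, 0, 0, 0, 0, 1, 0, 0, 0, 1, 0, 0, 3, 0, 0, 6;
    0, 6, 0, 3, 0, 0, 0, 0, 0, 0, 5, 0, 0, 1, 0, 0, 3;
    0, 0, 5, 0, 0, 4, 0, 0, 0, 5, 0, 0, 0, 0, 0, 0, 0;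
    5, 0, 0, 0, 0, 2, 0, 0, 4, 4, 0, 0, 1, 0, 0, 0, 0;
    0, 0, 0, 0, 4, 0, 0, 4, 0, 0, 0, 2, 0, 0, 3, 3, 0;
    0, 0, 0, 4, 0, 0, 1, 0, 0, 0, 3, 0, 0, 0, 0, 0, 0;
    0, 0, 2, 0, 0, 5, 0, 0, 0, 6, 0, 0, 0, 0, 0, 0, 0;
    0, 0, 0, 0, 1, 0, 0, 4, 0, 0, 0, 5, 0, 0, 3, 4, 0;
    0, 1, 0, 1, 0, 0, 5, 0, 0, 0, 5, 0, 0, 6, 0, 0, 5;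
    0, 0, 3, 0, 0, 6, 0, 0, 0, 1, 0, 0, 0, 0, 0, 0, 0;
    0, 6, 0, 0, 0, 0, 0, 0, 0, 0, 0, 0, 0, 2, 0, 0, 0;
    0, 0, 0, 0, 0, 0, 0, 0, 5, 0, 0, 0, 0, 0, 0, 0, 0;
    0, 0, 0, 0, 4, 0, 0, 0, 0, 0, 0, 0, 0, 0, 0, 0, 0;
    0, 2, 0, 0, 0, 0, 0, 0, 0, 0, 0, 0, 0, 5, 0, 0, 0]
def jlit : Matrix (Fin 17) (Fin 17) (ZMod 7) := !![1, 0, 0, 0, 0, 1, 0, 0, 0, 1, 0, 0, 1, 0, 0, 0, 0;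
    0, 0, 0, 0, 0, 0, 0, 0, 0, 0, 0, 0, 0, 1, 0, 0, 1;
    0, 0, 0, 0, 0, 3, 0, 0, 0, 2, 0, 0, 1, 0, 0, 0, 0;
    0, 0, 0, 1, 1, 0, 0, 0, 1, 0, 0, 1, 0, 0, 0, 0, 5;
    0, 0, 0, 0, 0, 0, 0, 0, 0, 0, 0, 0, 0, 0, 0, 2, 0;
    0, 0, 0, 0, 0, 5, 0, 0, 0, 3, 0, 0, 6, 0, 0, 0, 0;
    0, 0, 0, 4, 5, 0, 0, 0, 1, 0, 0, 2, 0, 0, 0, 0, 4;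
    0, 1, 1, 0, 0, 0, 0, 1, 0, 0, 1, 0, 0, 0, 0, 4, 0;
    0, 0, 0, 0, 0, 0, 0, 0, 0, 0, 0, 0, 0, 0, 3, 0, 0;
    0, 0, 0, 0, 0, 3, 0, 0, 0, 4, 0, 0, 4, 0, 0, 0, 0;
    0, 0, 0, 2, 4, 0, 0, 0, 1, 0, 0, 5, 0, 0, 0, 0, 6;
    0, 5, 1, 0, 0, 0, 0, 2, 0, 0, 5, 0, 0, 0, 0, 2, 0;
    2, 0, 0, 0, 0, 1, 1, 0, 0, 1, 0, 0, 2, 0, 2, 0, 0;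
    0, 0, 0, 0, 0, 0, 0, 0, 0, 0, 0, 0, 0, 1, 0, 0, 4;
    0, 1, 1, 0, 0, 0, 0, 0, 0, 0, 0, 0, 0, 0, 0, 0, 0;
    0, 6, 4, 0, 0, 0, 0, 0, 0, 0, 0, 0, 0, 0, 0, 0, 0;
    0, 0, 0, 5, 2, 0, 0, 0, 2, 0, 0, 0, 0, 0, 0, 0, 5]

def jmat (S : Type*) [CommRing S] : Matrix (Fin 17) (Fin 17) S :=
  Matrix.of fun i k => wgrad px py 1 (wds i) (pvar k).1 (pvar k).2.2 (pvar k).2.1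

theorem jlit_inv : jlit * jinv = 1 := by decide +kernel

theorem jmat_lit : jmat (ZMod 7) = jlit := by decide +kernel


theorem jmat_map {S T : Type*} [CommRing S] [CommRing T] (f : S →+* T) : f.mapMatrix (jmat S) = jmat T := by
  have hx : f.mapMatrix (px : Mat4 S) = px := by
    ext i j; fin_cases i <;> fin_cases j <;> simp [px]
    · exact map_ofNat f 5
    · exact map_ofNat f 4
  have hy : f.mapMatrix (py : Mat4 S) = py := by
    ext i j; fin_cases i <;> fin_cases j <;> simp [py]
  ext i k
  have := wgrad_map f px py 1 (wds i) (pvar k).1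
  rw [hx, hy, _root_.map_one] at this
  exact congrFun (congrFun this _) _

theorem jmat_det (K : Type*) [Field K] [CharZero K] : (jmat K).det ≠ 0 := by
  have h1 : (jmat ℤ).det ≠ 0 := by
    intro h
    have h2 : (jmat (ZMod 7)).det = 0 := by
      rw [← jmat_map (Int.castRingHom (ZMod 7)), ← RingHom.map_det, h, _root_.map_zero]
    have h3 := congrArg Matrix.det jlit_inv
    rw [det_mul, ← jmat_lit, h2, zero_mul, det_one] at h3
    exact absurd h3 (by decide)
  rw [← jmat_map (Int.castRingHom K), ← RingHom.map_det]
  simpa using h1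

theorem hsop_indep (K : Type*) [Field K] [CharZero K] : AlgebraicIndependent K (hsop17 K) := by
  apply jac_crit (hsop17 K) (fun k => wvar (pvar k).1 (pvar k).2.1 (pvar k).2.2)
  intro h0
  apply jmat_det K
  have h1 : (aeval (pairSub px py) : PR K →ₐ[K] K).toRingHom.mapMatrix
      (Matrix.of fun i k => pderiv (wvar (pvar k).1 (pvar k).2.1 (pvar k).2.2) (hsop17 K i)) = jmat K := by
    ext i k
    have h2 := wgrad_map (aeval (pairSub px py) : PR K →ₐ[K] K).toRingHom (genX K 4) (genY K 4) 1 (wds i) (pvar k).1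
    have hx : (aeval (pairSub px py) : PR K →ₐ[K] K).toRingHom.mapMatrix (genX K 4) = px := ev_genX px py
    have hy : (aeval (pairSub px py) : PR K →ₐ[K] K).toRingHom.mapMatrix (genY K 4) = py := ev_genY px py
    rw [hx, hy, _root_.map_one] at h2
    simp only [pd_hsop]
    exact congrFun (congrFun h2 _) _
  rw [← h1, ← RingHom.map_det, h0, _root_.map_zero]

end part12

/-- (Teranishi) The 17 traces of `x, y, x², xy, y², x³, x²y, xy², y³, x⁴, x³y, x²y², xy³,
y⁴, xyxy, (x²y)², (y²x)²` form a homogeneous system of parameters of `C_{4,2}`: they are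
invariants, homogeneous, algebraically independent, their number is the Krull dimension 17
of `C_{4,2}`, and `C_{4,2}` is a finitely generated module over the subalgebra they
generate. -/
theorem hsop_C42 (K : Type*) [Field K] [CharZero K] :
    (∀ i, hsop17 K i ∈ pureAlg K 4) ∧
    (∀ i, ∃ d : ℕ, (hsop17 K i).IsHomogeneous d) ∧
    AlgebraicIndependent K (hsop17 K) ∧
    ringKrullDim ↥(pureAlg K 4) = 17 ∧
    (∃ (m : ℕ) (Q : Fin m → MvPolynomial (MatVar 4) K),
      (∀ j, Q j ∈ pureAlg K 4) ∧
      ∀ f ∈ pureAlg K 4, ∃ c : Fin m → MvPolynomial (MatVar 4) K,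
        (∀ j, c j ∈ Algebra.adjoin K (Set.range (hsop17 K))) ∧ f = ∑ j, c j * Q j) := by
  refine ⟨hsop_inv, fun i => ⟨hdeg i, hsop_homog i⟩, hsop_indep K, ?_, hsop_fin K⟩
  obtain ⟨m, Q, hQ, hf⟩ := hsop_fin K
  have := krull_of_fin (pureAlg K 4) 17 (hsop17 K) hsop_inv (hsop_indep K) m Q hQ hf
  exact_mod_cast this
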